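/- arXiv:2412.11879 — 3 statements merged into one kernel-verified Lean document; each statement's English description precedes it below -/
import Mathlib

section
/- For every s ∈ ℂ with Re(s) > 1: (1 + 2e^{iπs} + 2e^{2iπs} + e^{3iπs}) · Σ_{m,n ≥ 1} 1/(m·n·(m+n))^s = ((2πi)^s/Γ(s))³ · ∫_0^1 ζ(1−s, x) · ζ(1−s, 1−x)² dx, where the double sum ranges over all pairs of positive integers (m,n), the power (m·n·(m+n))^{−s} is the complex power of a positive real, (2πi)^s is the principal complex power, Γ is the Gamma function, and the integral is over x ∈ (0,1). -/
open Complex MeasureTheory HurwitzZeta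

/-- The integral over a period of an additive character of `ℝ / ℤ`. -/
lemma integral_exp_two_pi_int_mul (k : ℤ) :
    ∫ x in (0 : ℝ)..1, Complex.exp (2 * Real.pi * I * k * x) = if k = 0 then 1 else 0 := by
  split_ifs with hk
  · simp [hk]
  · have h : (2 * Real.pi * I * k : ℂ) ≠ 0 := by
      simp [hk, Real.pi_ne_zero]
    rw [integral_exp_mul_complex h]
    have : Complex.exp (2 * Real.pi * I * k * (1 : ℝ)) = 1 := by
      rw [Complex.exp_eq_one_iff]
      exact ⟨k, by push_cast; ring⟩
    rw [this]
    simp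

lemma norm_exp_two_pi_int_mul (k : ℤ) (x : ℝ) :
    ‖Complex.exp (2 * Real.pi * I * k * x)‖ = 1 := by
  rw [show (2 * Real.pi * I * k * x : ℂ) = ((2 * Real.pi * k * x : ℝ) : ℂ) * I by push_cast; ring]
  exact Complex.norm_exp_ofReal_mul_I _

/-- The Fourier series `∑ c n e(k n x)`. -/
noncomputable def fourierSum (c : ℕ → ℂ) (k : ℤ) (x : ℝ) : ℂ :=
  ∑' n : ℕ, c n * Complex.exp (2 * Real.pi * I * ((k * n : ℤ) : ℂ) * x)

lemma continuous_fourierSum {c : ℕ → ℂ} (hc : Summable fun n ↦ ‖c n‖) (k : ℤ) :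
    Continuous (fourierSum c k) := by
  refine continuous_tsum (fun n ↦ by fun_prop) hc fun n x ↦ ?_
  rw [norm_mul, norm_exp_two_pi_int_mul, mul_one]

lemma integral_fourierSum_mul_mul {c : ℕ → ℂ} (hc : Summable fun n ↦ ‖c n‖) (i j k : ℤ) :
    ∫ x in (0 : ℝ)..1, fourierSum c i x * fourierSum c j x * fourierSum c k x =
      ∑' p : (ℕ × ℕ) × ℕ, c p.1.1 * c p.1.2 * c p.2 *
        if i * p.1.1 + j * p.1.2 + k * p.2 = 0 then 1 else 0 := by
  have hs (k : ℤ) (x : ℝ) :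
      Summable fun n : ℕ ↦ ‖c n * Complex.exp (2 * Real.pi * I * ((k * n : ℤ) : ℂ) * x)‖ := by
    simpa only [norm_mul, norm_exp_two_pi_int_mul, mul_one] using hc
  have hc3 : Summable fun p : (ℕ × ℕ) × ℕ ↦ ‖c p.1.1 * c p.1.2 * c p.2‖ :=
    (hc.mul_norm hc).mul_norm hc
  have key (x : ℝ) : fourierSum c i x * fourierSum c j x * fourierSum c k x =
      ∑' p : (ℕ × ℕ) × ℕ, c p.1.1 * c p.1.2 * c p.2 * Complex.exp (2 * Real.pi * I *
        ((i * p.1.1 + j * p.1.2 + k * p.2 : ℤ) : ℂ) * x) := by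
    rw [fourierSum, fourierSum, fourierSum, tsum_mul_tsum_of_summable_norm (hs i x) (hs j x),
      tsum_mul_tsum_of_summable_norm ((hs i x).mul_norm (hs j x)) (hs k x)]
    refine tsum_congr fun p ↦ ?_
    have : Complex.exp (2 * Real.pi * I * ((i * p.1.1 + j * p.1.2 + k * p.2 : ℤ) : ℂ) * x) =
        Complex.exp (2 * Real.pi * I * ((i * p.1.1 : ℤ) : ℂ) * x) *
        Complex.exp (2 * Real.pi * I * ((j * p.1.2 : ℤ) : ℂ) * x) *
        Complex.exp (2 * Real.pi * I * ((k * p.2 : ℤ) : ℂ) * x) := by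
      rw [← Complex.exp_add, ← Complex.exp_add]
      congr 1
      push_cast
      ring
    rw [this]
    ring
  simp_rw [key]
  have h_integral := intervalIntegral.hasSum_integral_of_dominated_convergence
    (μ := volume) (a := 0) (b := 1)
    (F := fun (p : (ℕ × ℕ) × ℕ) (x : ℝ) ↦ c p.1.1 * c p.1.2 * c p.2 * Complex.exp (2 * Real.pi *
      I * ((i * p.1.1 + j * p.1.2 + k * p.2 : ℤ) : ℂ) * x))
    (f := fun x ↦ ∑' p : (ℕ × ℕ) × ℕ, c p.1.1 * c p.1.2 * c p.2 * Complex.exp (2 * Real.pi * I *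
        ((i * p.1.1 + j * p.1.2 + k * p.2 : ℤ) : ℂ) * x))
    (fun p _ ↦ ‖c p.1.1 * c p.1.2 * c p.2‖)
    (fun p ↦ (by fun_prop : Continuous _).aestronglyMeasurable)
    (fun p ↦ .of_forall fun x _ ↦ by rw [norm_mul, norm_exp_two_pi_int_mul, mul_one])
    (.of_forall fun x _ ↦ hc3)
    intervalIntegrable_const
    (.of_forall fun x _ ↦ (Summable.of_norm (by
      simpa only [norm_mul, norm_exp_two_pi_int_mul, mul_one] using hc3)).hasSum)
  rw [← h_integral.tsum_eq]
  refine tsum_congr fun p ↦ ?_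
  rw [intervalIntegral.integral_const_mul, integral_exp_two_pi_int_mul]

lemma integral_fourierSum_pow_three_eq_zero {c : ℕ → ℂ} (hc : Summable fun n ↦ ‖c n‖)
    (hc0 : c 0 = 0) {i : ℤ} (hi : i ≠ 0) :
    ∫ x in (0 : ℝ)..1, fourierSum c i x * fourierSum c i x * fourierSum c i x = 0 := by
  rw [integral_fourierSum_mul_mul hc]
  refine (tsum_congr fun ⟨⟨l, m⟩, n⟩ ↦ ?_).trans tsum_zero
  split_ifs with h
  · have h' : i * ((l : ℤ) + m + n) = 0 := by linear_combination h
    have : l = 0 := by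
      have := (mul_eq_zero.mp h').resolve_left hi
      lia
    simp [this, hc0]
  · simp

lemma integral_fourierSum_mul_self_mul_neg {c : ℕ → ℂ} (hc : Summable fun n ↦ ‖c n‖)
    (hc0 : c 0 = 0) {i : ℤ} (hi : i ≠ 0) :
    ∫ x in (0 : ℝ)..1, fourierSum c i x * fourierSum c i x * fourierSum c (-i) x =
      ∑' p : ℕ+ × ℕ+, c p.1 * c p.2 * c (p.1 + p.2) := by
  have hiff (l m n : ℕ) : i * (l : ℤ) + i * m + -i * n = 0 ↔ n = l + m := by
    rw [show i * (l : ℤ) + i * m + -i * n = i * ((l : ℤ) + m - n) by ring, mul_eq_zero,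
      or_iff_right hi]
    lia
  rw [integral_fourierSum_mul_mul hc]
  let g : ℕ+ × ℕ+ → (ℕ × ℕ) × ℕ := fun p ↦ ((p.1, p.2), p.1 + p.2)
  have hg : Function.Injective g := fun p q h ↦ by
    simp only [g, Prod.mk.injEq, PNat.coe_inj] at h
    exact Prod.ext h.1.1 h.1.2
  rw [← hg.tsum_eq]
  · refine tsum_congr fun p ↦ ?_
    simp only [g, hiff, if_true, mul_one]
  · rintro ⟨⟨l, m⟩, n⟩ h
    simp only [Function.mem_support, hiff, ne_eq, mul_eq_zero, not_or, ite_eq_right_iff,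
      one_ne_zero, imp_false, not_not] at h
    obtain ⟨⟨⟨hl, hm⟩, -⟩, rfl⟩ := h
    have hl' : 0 < l := Nat.pos_of_ne_zero fun h ↦ hl (h ▸ hc0)
    have hm' : 0 < m := Nat.pos_of_ne_zero fun h ↦ hm (h ▸ hc0)
    exact ⟨(⟨l, hl'⟩, ⟨m, hm'⟩), rfl⟩

lemma expZeta_eq_fourierSum {s : ℂ} (hs : 1 < s.re) (x : ℝ) :
    expZeta (x : UnitAddCircle) s = fourierSum (fun n ↦ 1 / (n : ℂ) ^ s) 1 x := by
  rw [← (hasSum_expZeta_of_one_lt_re x hs).tsum_eq, fourierSum]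
  refine tsum_congr fun n ↦ ?_
  rw [div_eq_inv_mul, one_div]
  congr 2
  push_cast
  ring

lemma expZeta_neg_eq_fourierSum {s : ℂ} (hs : 1 < s.re) (x : ℝ) :
    expZeta (-x : UnitAddCircle) s = fourierSum (fun n ↦ 1 / (n : ℂ) ^ s) (-1) x := by
  rw [← AddCircle.coe_neg, expZeta_eq_fourierSum hs, fourierSum, fourierSum]
  refine tsum_congr fun n ↦ ?_
  congr 2
  push_cast
  ring

/-- The functional equation of the Hurwitz zeta function, normalized so that only powers of
`e^{iπs}` occur. -/
lemma two_pi_I_cpow_div_Gamma_mul_hurwitzZeta {s : ℂ} (hs : 1 < s.re) (a : UnitAddCircle) :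
    (2 * Real.pi * I) ^ s / Complex.Gamma s * hurwitzZeta a (1 - s) =
      expZeta a s + Complex.exp (Real.pi * I * s) * expZeta (-a) s := by
  have hΓ : Complex.Gamma s ≠ 0 := Complex.Gamma_ne_zero_of_re_pos (by linarith)
  have hpow : (2 * Real.pi * I : ℂ) ^ s =
      (2 * Real.pi : ℂ) ^ s * Complex.exp (Real.pi * I * s / 2) := by
    have h2π : ((2 * Real.pi : ℝ) : ℂ) ≠ 0 := by simp [Real.pi_ne_zero]
    rw [show (2 * Real.pi : ℂ) = ((2 * Real.pi : ℝ) : ℂ) by push_cast; rfl,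
      Complex.cpow_def_of_ne_zero (mul_ne_zero h2π I_ne_zero), Complex.cpow_def_of_ne_zero h2π,
      Complex.log_ofReal_mul Real.two_pi_pos I_ne_zero, Complex.log_I,
      Complex.ofReal_log Real.two_pi_pos.le, ← Complex.exp_add]
    congr 1
    ring
  have hπ : (2 * Real.pi : ℂ) ^ s ≠ 0 := by
    rw [Ne, Complex.cpow_eq_zero_iff]
    simp [Real.pi_ne_zero]
  rw [hurwitzZeta_one_sub a (fun n h ↦ by simp [h] at hs; linarith [n.cast_nonneg (α := ℝ)])
    (.inr fun h ↦ by simp [h] at hs), hpow, Complex.cpow_neg]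
  have h1 : Complex.exp (Real.pi * I * s / 2) * Complex.exp (-(Real.pi * I * s / 2)) = 1 := by
    rw [← Complex.exp_add, ← Complex.exp_zero]
    congr 1
    ring
  have h2 : Complex.exp (Real.pi * I * s) =
      Complex.exp (Real.pi * I * s / 2) * Complex.exp (Real.pi * I * s / 2) := by
    rw [← Complex.exp_add]
    congr 1
    ring
  rw [h2, show -Real.pi * I * s / 2 = -(Real.pi * I * s / 2) by ring]
  field_simp
  linear_combination expZeta a s * h1

/-- Integral representation for the Witten zeta function of `A₂`:
for `Re(s) > 1`,
`(1 + 2e^{iπs} + 2e^{2iπs} + e^{3iπs}) Σ_{m,n≥1} (mn(m+n))^{-s}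
  = ((2πi)^s/Γ(s))³ ∫_0^1 ζ(1-s,x) ζ(1-s,1-x)² dx`. -/
theorem stmt_4 (s : ℂ) (hs : 1 < s.re) :
    (1 + 2 * Complex.exp (Real.pi * I * s) + 2 * Complex.exp (2 * Real.pi * I * s) +
        Complex.exp (3 * Real.pi * I * s)) *
      ∑' p : ℕ+ × ℕ+, 1 / (((p.1 : ℕ) : ℂ) * ((p.2 : ℕ) : ℂ) *
        (((p.1 : ℕ) : ℂ) + ((p.2 : ℕ) : ℂ))) ^ s =
    ((2 * Real.pi * I) ^ s / Complex.Gamma s) ^ 3 *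
      ∫ x in Set.Ioo (0 : ℝ) 1,
        hurwitzZeta (x : UnitAddCircle) (1 - s) *
          hurwitzZeta ((1 - x : ℝ) : UnitAddCircle) (1 - s) ^ 2 := by
  set c : ℕ → ℂ := fun n ↦ 1 / (n : ℂ) ^ s with hcdef
  have hc : Summable fun n ↦ ‖c n‖ := (Complex.summable_one_div_nat_cpow.mpr hs).norm
  have hc0 : c 0 = 0 := by
    have : s ≠ 0 := fun h ↦ by simp [h] at hs; linarith
    simp [c, this]
  have hW : ∑' p : ℕ+ × ℕ+, 1 / (((p.1 : ℕ) : ℂ) * ((p.2 : ℕ) : ℂ) *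
      (((p.1 : ℕ) : ℂ) + ((p.2 : ℕ) : ℂ))) ^ s =
      ∑' p : ℕ+ × ℕ+, c p.1 * c p.2 * c (p.1 + p.2) := by
    refine tsum_congr fun p ↦ ?_
    simp only [c]
    rw [← Nat.cast_add, ← Nat.cast_mul, Complex.natCast_mul_natCast_cpow, Nat.cast_mul,
      Complex.natCast_mul_natCast_cpow]
    field_simp
  set q := Complex.exp (Real.pi * I * s) with hq
  have hq2 : Complex.exp (2 * Real.pi * I * s) = q ^ 2 := by
    rw [hq, ← Complex.exp_nat_mul]
    congr 1
    push_cast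
    ring
  have hq3 : Complex.exp (3 * Real.pi * I * s) = q ^ 3 := by
    rw [hq, ← Complex.exp_nat_mul]
    congr 1
    push_cast
    ring
  rw [hW, hq2, hq3, ← integral_const_mul, ← integral_Ioc_eq_integral_Ioo,
    ← intervalIntegral.integral_of_le zero_le_one]
  set P := fourierSum c 1 with hP
  set N := fourierSum c (-1) with hN
  have hPc : Continuous P := continuous_fourierSum hc 1
  have hNc : Continuous N := continuous_fourierSum hc (-1)
  have h_integral (x : ℝ) : ((2 * Real.pi * I) ^ s / Complex.Gamma s) ^ 3 *
      (hurwitzZeta (x : UnitAddCircle) (1 - s) *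
        hurwitzZeta ((1 - x : ℝ) : UnitAddCircle) (1 - s) ^ 2) =
      (1 + 2 * q ^ 2) * (N x * N x * P x) + (2 * q + q ^ 3) * (P x * P x * N x) +
        q ^ 2 * (P x * P x * P x) + q * (N x * N x * N x) := by
    have h1 := two_pi_I_cpow_div_Gamma_mul_hurwitzZeta hs (x : UnitAddCircle)
    have h2 := two_pi_I_cpow_div_Gamma_mul_hurwitzZeta hs (-x : UnitAddCircle)
    have hx : ((1 - x : ℝ) : UnitAddCircle) = -x := by
      rw [AddCircle.coe_sub, AddCircle.coe_period, zero_sub]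
    rw [neg_neg] at h2
    rw [expZeta_eq_fourierSum hs, expZeta_neg_eq_fourierSum hs, ← hcdef, ← hP, ← hN, ← hq]
      at h1 h2
    rw [hx]
    calc _ = ((2 * Real.pi * I) ^ s / Complex.Gamma s * hurwitzZeta (x : UnitAddCircle) (1 - s)) *
          ((2 * Real.pi * I) ^ s / Complex.Gamma s *
            hurwitzZeta (-x : UnitAddCircle) (1 - s)) ^ 2 := by ring
      _ = _ := by
        rw [h1, h2]
        ring
  simp_rw [h_integral]
  have hPPN : ∫ x in (0 : ℝ)..1, P x * P x * N x = ∑' p : ℕ+ × ℕ+, c p.1 * c p.2 * c (p.1 + p.2) :=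
    integral_fourierSum_mul_self_mul_neg hc hc0 one_ne_zero
  have hNNP : ∫ x in (0 : ℝ)..1, N x * N x * P x =
      ∑' p : ℕ+ × ℕ+, c p.1 * c p.2 * c (p.1 + p.2) := by
    simpa using integral_fourierSum_mul_self_mul_neg hc hc0 (i := -1) (by simp)
  have hPPP : ∫ x in (0 : ℝ)..1, P x * P x * P x = 0 :=
    integral_fourierSum_pow_three_eq_zero hc hc0 one_ne_zero
  have hNNN : ∫ x in (0 : ℝ)..1, N x * N x * N x = 0 :=
    integral_fourierSum_pow_three_eq_zero hc hc0 (by simp)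
  rw [intervalIntegral.integral_add, intervalIntegral.integral_add, intervalIntegral.integral_add,
    intervalIntegral.integral_const_mul, intervalIntegral.integral_const_mul,
    intervalIntegral.integral_const_mul, intervalIntegral.integral_const_mul,
    hPPN, hNNP, hPPP, hNNN]
  · ring
  all_goals exact (by fun_prop : Continuous _).intervalIntegrable _ _
end

section
/- For every s ∈ ℂ with Re(s) > 1: (1 + 2e^{iπs} + 2e^{2iπs} + 2e^{3iπs} + e^{4iπs}) · Σ_{m,n ≥ 1} 1/(m·n·(m+n)·(m+2n))^s = ((2πi)^s/Γ(s))⁴ · ∫_{[0,1]²} ζ(1−s, x₁) · ζ(1−s, x₂) · ζ(1−s, −x₁−2x₂) · ζ(1−s, −x₁−x₂) dx₁ dx₂, where the double sum ranges over all pairs of positive integers (m,n), the power (m·n·(m+n)·(m+2n))^{−s} is the complex power of a positive real, and (2πi)^s is the principal complex power. -/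
open Complex MeasureTheory HurwitzZeta

lemma norm_fourier_apply {T : ℝ} (n : ℤ) (x : AddCircle T) : ‖fourier n x‖ = 1 := by
  rw [fourier_apply]
  exact Circle.norm_coe _

section AbsolutelyConvergentFourierSeries

variable {c : ℤ → ℂ} {G : UnitAddCircle → ℂ}

lemma continuous_of_hasSum_fourier (hc : Summable fun n ↦ ‖c n‖)
    (hG : ∀ x, HasSum (fun n ↦ c n * fourier n x) (G x)) : Continuous G := by
  have h : G = fun x ↦ ∑' n, c n * fourier n x := funext fun x ↦ (hG x).tsum_eq.symm
  rw [h]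
  refine continuous_tsum (fun n ↦ by fun_prop) hc fun n x ↦ ?_
  rw [norm_mul, norm_fourier_apply, mul_one]

lemma norm_le_of_hasSum_fourier (hc : Summable fun n ↦ ‖c n‖)
    (hG : ∀ x, HasSum (fun n ↦ c n * fourier n x) (G x)) (x : UnitAddCircle) :
    ‖G x‖ ≤ ∑' n, ‖c n‖ := by
  refine (hG x).norm_le_of_bounded hc.hasSum fun n ↦ ?_
  rw [norm_mul, norm_fourier_apply, mul_one]

lemma hasSum_mul_of_hasSum_fourier (hc : Summable fun n ↦ ‖c n‖)
    (hG : ∀ x, HasSum (fun n ↦ c n * fourier n x) (G x)) (x y : UnitAddCircle) :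
    HasSum (fun p : ℤ × ℤ ↦ (c p.1 * fourier p.1 x) * (c p.2 * fourier p.2 y)) (G x * G y) := by
  have hnorm (z : UnitAddCircle) : Summable fun n ↦ ‖c n * fourier n z‖ := by
    simpa only [norm_mul, norm_fourier_apply, mul_one] using hc
  exact HasSum.mul (f := fun n ↦ c n * fourier n x) (g := fun n ↦ c n * fourier n y) (hG x) (hG y)
    (summable_mul_of_summable_norm (f := fun n ↦ c n * fourier n x)
      (g := fun n ↦ c n * fourier n y) (hnorm x) (hnorm y))

lemma setIntegral_fourier (n : ℤ) :
    ∫ x in Set.Ioo (0 : ℝ) 1, fourier n (x : UnitAddCircle) = if n = 0 then 1 else 0 := by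
  have h := fourierCoeff_eq_intervalIntegral (T := 1) (fourier n) 0 0
  rw [fourierCoeff_fourier, intervalIntegral.integral_of_le (by norm_num)] at h
  rw [← integral_Ioc_eq_integral_Ioo]
  simp only [neg_zero, fourier_zero, one_smul, zero_add, div_one] at h
  rw [← h, Pi.single_apply]
  simp only [eq_comm]

lemma setIntegral_mul_fourier_neg (hc : Summable fun n ↦ ‖c n‖)
    (hG : ∀ x, HasSum (fun n ↦ c n * fourier n x) (G x)) (k : ℤ) :
    ∫ x in Set.Ioo (0 : ℝ) 1, G x * fourier (-k) (x : UnitAddCircle) = c k := by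
  have hcont (n : ℤ) : Continuous fun x : ℝ ↦ c n * fourier (n - k) (x : UnitAddCircle) :=
    continuous_const.mul ((fourier (n - k)).continuous.comp (AddCircle.continuous_mk' 1))
  have hnorm (n : ℤ) (x : ℝ) : ‖c n * fourier (n - k) (x : UnitAddCircle)‖ = ‖c n‖ := by
    rw [norm_mul, norm_fourier_apply, mul_one]
  have key := hasSum_integral_of_summable_integral_norm
    (μ := volume.restrict (Set.Ioo (0 : ℝ) 1))
    (F := fun n x ↦ c n * fourier (n - k) (x : UnitAddCircle))
    (fun n ↦ Integrable.of_bound (hcont n).aestronglyMeasurable ‖c n‖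
      (ae_of_all _ fun x ↦ (hnorm n x).le)) (by simp only [hnorm]; simpa using hc)
  have hsum (x : ℝ) : ∑' n, c n * fourier (n - k) (x : UnitAddCircle) =
      G x * fourier (-k) (x : UnitAddCircle) := by
    rw [← ((hG x).mul_right _).tsum_eq]
    simp only [sub_eq_add_neg, fourier_add, mul_assoc]
  simp only [hsum, integral_const_mul, setIntegral_fourier] at key
  refine key.unique ?_
  convert hasSum_single k fun n hn ↦ ?_ using 1
  · simp
  · simp [sub_eq_zero, hn]

/-- Integrating a product of four absolutely convergent Fourier series over the torus extracts the
series over the root lattice of `B₂`. -/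
lemma setIntegral_fourier_B₂ (hc : Summable fun n ↦ ‖c n‖)
    (hG : ∀ x, HasSum (fun n ↦ c n * fourier n x) (G x)) :
    HasSum (fun p : ℤ × ℤ ↦ c p.1 * c p.2 * c (p.1 + p.2) * c (p.1 + 2 * p.2))
      (∫ x in (Set.Ioo (0 : ℝ) 1 ×ˢ Set.Ioo (0 : ℝ) 1),
        G x.1 * G x.2 * G ((-x.1 - 2 * x.2 : ℝ) : UnitAddCircle) *
          G ((-x.1 - x.2 : ℝ) : UnitAddCircle)) := by
  set μ := (volume : Measure (ℝ × ℝ)).restrict (Set.Ioo (0 : ℝ) 1 ×ˢ Set.Ioo (0 : ℝ) 1)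
  have hμ : μ = (volume.restrict (Set.Ioo (0 : ℝ) 1)).prod
      (volume.restrict (Set.Ioo (0 : ℝ) 1)) := by
    rw [Measure.prod_restrict, ← Measure.volume_eq_prod]
  have : IsFiniteMeasure μ := by rw [hμ]; infer_instance
  have hGc := continuous_of_hasSum_fourier hc hG
  set C := ∑' n, ‖c n‖
  have hGn : ∀ x, ‖G x‖ ≤ C := norm_le_of_hasSum_fourier hc hG
  have hC : 0 ≤ C := tsum_nonneg fun _ ↦ norm_nonneg _
  have hcc := hc.mul_norm hc
  let F (p : ℤ × ℤ) (x : ℝ × ℝ) : ℂ :=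
    c p.1 * c p.2 * ((G x.1 * fourier (-(p.1 + p.2)) (x.1 : UnitAddCircle)) *
      (G x.2 * fourier (-(p.1 + 2 * p.2)) (x.2 : UnitAddCircle)))
  have hF (p : ℤ × ℤ) : Continuous (F p) := by
    have h₁ : Continuous fun x : ℝ × ℝ ↦ (x.1 : UnitAddCircle) :=
      (AddCircle.continuous_mk' 1).comp continuous_fst
    have h₂ : Continuous fun x : ℝ × ℝ ↦ (x.2 : UnitAddCircle) :=
      (AddCircle.continuous_mk' 1).comp continuous_snd
    exact continuous_const.mul (((hGc.comp h₁).mul ((fourier _).continuous.comp h₁)).mul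
      ((hGc.comp h₂).mul ((fourier _).continuous.comp h₂)))
  have hFn (p : ℤ × ℤ) (x : ℝ × ℝ) : ‖F p x‖ ≤ ‖c p.1 * c p.2‖ * (C * C) := by
    simp only [F, norm_mul, norm_fourier_apply, mul_one]
    gcongr <;> apply hGn
  have hFi (p : ℤ × ℤ) : Integrable (F p) μ :=
    Integrable.of_bound (hF p).aestronglyMeasurable _ (ae_of_all _ (hFn p))
  have hsum : Summable fun p ↦ ∫ x, ‖F p x‖ ∂μ := by
    refine Summable.of_nonneg_of_le (fun p ↦ integral_nonneg fun x ↦ norm_nonneg _) (fun p ↦ ?_)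
      ((hcc.mul_right (C * C)).mul_left (μ.real Set.univ))
    calc ∫ x, ‖F p x‖ ∂μ ≤ ∫ _, ‖c p.1 * c p.2‖ * (C * C) ∂μ :=
          integral_mono (hFi p).norm (integrable_const _) (hFn p)
      _ = _ := by simp
  have hcoeff (p : ℤ × ℤ) :
      ∫ x, F p x ∂μ = c p.1 * c p.2 * c (p.1 + p.2) * c (p.1 + 2 * p.2) := by
    simp only [F, integral_const_mul]
    rw [hμ, integral_prod_mul (fun x : ℝ ↦ G x * fourier (-(p.1 + p.2)) (x : UnitAddCircle))
      (fun x : ℝ ↦ G x * fourier (-(p.1 + 2 * p.2)) (x : UnitAddCircle)),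
      setIntegral_mul_fourier_neg hc hG, setIntegral_mul_fourier_neg hc hG, ← mul_assoc]
  have htsum (x : ℝ × ℝ) : ∑' p, F p x = G x.1 * G x.2 *
      G ((-x.1 - 2 * x.2 : ℝ) : UnitAddCircle) * G ((-x.1 - x.2 : ℝ) : UnitAddCircle) := by
    have h := (hasSum_mul_of_hasSum_fourier hc hG ((-x.1 - x.2 : ℝ) : UnitAddCircle)
      ((-x.1 - 2 * x.2 : ℝ) : UnitAddCircle)).mul_left (G x.1 * G x.2)
    rw [mul_assoc (G x.1 * G x.2), mul_comm (G ((-x.1 - 2 * x.2 : ℝ) : UnitAddCircle))]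
    refine Eq.trans (tsum_congr fun p ↦ ?_) h.tsum_eq
    have he : fourier p.1 ((-x.1 - x.2 : ℝ) : UnitAddCircle) *
        fourier p.2 ((-x.1 - 2 * x.2 : ℝ) : UnitAddCircle) =
        fourier (-(p.1 + p.2)) (x.1 : UnitAddCircle) *
        fourier (-(p.1 + 2 * p.2)) (x.2 : UnitAddCircle) := by
      simp only [fourier_coe_apply, ← Complex.exp_add]
      congr 1
      push_cast
      ring
    simp only [F]
    linear_combination -(c p.1 * c p.2 * G x.1 * G x.2) * he
  simpa only [hcoeff, htsum] using hasSum_integral_of_summable_integral_norm hFi hsum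

end AbsolutelyConvergentFourierSeries

/-- The Fourier coefficients of `x ↦ ((2πi)^s / Γ(s)) ζ(1 - s, x)`. -/
noncomputable def hurwitzFourierCoeff (s : ℂ) (n : ℤ) : ℂ :=
  (if 0 ≤ n then 1 else exp (Real.pi * I * s)) / (n.natAbs : ℂ) ^ s

section

variable {s : ℂ}

lemma summable_norm_hurwitzFourierCoeff (hs : 1 < s.re) :
    Summable fun n ↦ ‖hurwitzFourierCoeff s n‖ := by
  have hs0 : s.re ≠ 0 := by linarith
  have h := Real.summable_one_div_nat_rpow.mpr hs
  have hbound : Summable fun n : ℤ ↦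
      (1 + ‖exp (Real.pi * I * s)‖) * (1 / (n.natAbs : ℝ) ^ s.re) :=
    (Summable.of_nat_of_neg (f := fun n : ℤ ↦ 1 / (n.natAbs : ℝ) ^ s.re)
      (by simpa using h) (by simpa using h)).mul_left _
  refine Summable.of_nonneg_of_le (fun _ ↦ norm_nonneg _) (fun n ↦ ?_) hbound
  rw [hurwitzFourierCoeff, norm_div, norm_natCast_cpow_of_re_ne_zero _ hs0, mul_one_div]
  gcongr
  split_ifs
  · simp
  · simp

lemma hasSum_hurwitzFourierCoeff (hs : 1 < s.re) (x : UnitAddCircle) :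
    HasSum (fun n ↦ hurwitzFourierCoeff s n * fourier n x)
      ((2 * Real.pi * I) ^ s / Gamma s * hurwitzZeta x (1 - s)) := by
  have hs0 : s ≠ 0 := by rintro rfl; norm_num at hs
  have hs1 : s ≠ 1 := by rintro rfl; norm_num at hs
  have hsn (n : ℕ) : s ≠ -n := by
    rintro rfl
    have : (0 : ℝ) ≤ n := n.cast_nonneg
    simp at hs
    linarith
  have hΓ : Gamma s ≠ 0 := Gamma_ne_zero hsn
  have hpi : (2 * Real.pi : ℂ) ≠ 0 := by simp [Real.pi_ne_zero]
  have hpow : (2 * Real.pi * I : ℂ) ^ s = (2 * Real.pi : ℂ) ^ s * exp (Real.pi * I * s / 2) := by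
    have h2 : (2 * Real.pi * I : ℂ) = ((2 * Real.pi : ℝ) : ℂ) * I := by push_cast; ring
    have h3 : Complex.log (2 * Real.pi * I) = Complex.log (2 * Real.pi) + Real.pi / 2 * I := by
      rw [h2, log_ofReal_mul (by positivity) I_ne_zero, log_I, ofReal_log (by positivity)]
      push_cast
      rfl
    rw [cpow_def_of_ne_zero (by simp [Real.pi_ne_zero]), cpow_def_of_ne_zero hpi, h3,
      ← Complex.exp_add]
    ring_nf
  induction x using QuotientAddGroup.induction_on with | H a => ?_
  have hpos := hasSum_expZeta_of_one_lt_re a hs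
  have hneg := (hasSum_expZeta_of_one_lt_re (-a) hs).mul_left (exp (Real.pi * I * s))
  convert! HasSum.of_nat_of_neg
    (f := fun n ↦ hurwitzFourierCoeff s n * fourier n (a : UnitAddCircle))
    (g := expZeta a s) (g' := exp (Real.pi * I * s) * expZeta ((-a : ℝ) : UnitAddCircle) s)
    ?_ ?_ using 1
  · have he : exp (-Real.pi * I * s / 2) * exp (Real.pi * I * s / 2) = 1 := by
      rw [← Complex.exp_add, ← Complex.exp_zero]
      ring_nf
    have he' : exp (Real.pi * I * s) = exp (Real.pi * I * s / 2) * exp (Real.pi * I * s / 2) := by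
      rw [← Complex.exp_add]
      ring_nf
    have hp : (2 * Real.pi : ℂ) ^ s * (2 * Real.pi : ℂ) ^ (-s) = 1 := by
      rw [← cpow_add _ _ hpi, add_neg_cancel, cpow_zero]
    have h0 : hurwitzFourierCoeff s 0 = 0 := by simp [hurwitzFourierCoeff, hs0]
    rw [h0, zero_mul, sub_zero, hurwitzZeta_one_sub _ hsn (Or.inr hs1), hpow, he',
      AddCircle.coe_neg, div_mul_eq_mul_div, div_eq_iff hΓ]
    generalize (2 * Real.pi : ℂ) ^ s = P at *
    generalize (2 * Real.pi : ℂ) ^ (-s) = Q at *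
    generalize exp (Real.pi * I * s / 2) = E at *
    generalize exp (-Real.pi * I * s / 2) = E' at *
    linear_combination (Gamma s * (E * E' * expZeta a s + E * E * expZeta (-a) s)) * hp +
      Gamma s * expZeta a s * he
  · refine hpos.congr_fun fun n ↦ ?_
    simp only [hurwitzFourierCoeff, fourier_coe_apply]
    simp
    ring_nf
  · refine hneg.congr_fun fun n ↦ ?_
    rcases Nat.eq_zero_or_pos n with rfl | hn
    · simp [hurwitzFourierCoeff, hs0]
    · have : ¬ (0 : ℤ) ≤ -n := by omega
      simp only [hurwitzFourierCoeff, fourier_coe_apply, if_neg this]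
      simp
      ring_nf

end

/-- The action of the Weyl group of `B₂` on the pairs of coordinates of roots, mapping the interior
of the dominant chamber to the eight open chambers. -/
def weylChamberB₂ (i : Fin 8) (p : ℕ+ × ℕ+) : ℤ × ℤ :=
  let m : ℤ := (p.1 : ℕ)
  let n : ℤ := (p.2 : ℕ)
  match i with
  | 0 => (m, n)
  | 1 => (m + 2 * n, -n)
  | 2 => (-m, m + n)
  | 3 => (m + 2 * n, -(m + n))
  | 4 => (-(m + 2 * n), m + n)
  | 5 => (m, -(m + n))
  | 6 => (-(m + 2 * n), n)
  | 7 => (-m, -n)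

lemma injective_weylChamberB₂ :
    Function.Injective fun q : Fin 8 × (ℕ+ × ℕ+) ↦ weylChamberB₂ q.1 q.2 := by
  rintro ⟨i, m, n⟩ ⟨j, m', n'⟩ h
  have := m.pos
  have := n.pos
  have := m'.pos
  have := n'.pos
  simp only [Prod.mk.injEq, ← PNat.coe_inj]
  fin_cases i <;> fin_cases j <;>
    simp only [weylChamberB₂, Prod.mk.injEq] at h <;>
    first
    | (exfalso; omega)
    | exact ⟨rfl, by omega, by omega⟩

lemma mem_range_weylChamberB₂ {a b : ℤ} (ha : a ≠ 0) (hb : b ≠ 0) (hab : a + b ≠ 0)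
    (hab' : a + 2 * b ≠ 0) :
    (a, b) ∈ Set.range fun q : Fin 8 × (ℕ+ × ℕ+) ↦ weylChamberB₂ q.1 q.2 := by
  have key (i : Fin 8) (m n : ℤ) (hm : 0 < m) (hn : 0 < n)
      (h : ∀ p : ℕ+ × ℕ+, ((p.1 : ℕ) : ℤ) = m → ((p.2 : ℕ) : ℤ) = n → weylChamberB₂ i p = (a, b)) :
      (a, b) ∈ Set.range fun q : Fin 8 × (ℕ+ × ℕ+) ↦ weylChamberB₂ q.1 q.2 := by
    lift m to ℕ using hm.le
    lift n to ℕ using hn.le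
    exact ⟨(i, ⟨m, by omega⟩, ⟨n, by omega⟩), h _ rfl rfl⟩
  rcases ha.lt_or_gt with h₁ | h₁ <;> rcases hb.lt_or_gt with h₂ | h₂ <;>
    rcases hab.lt_or_gt with h₃ | h₃ <;> rcases hab'.lt_or_gt with h₄ | h₄ <;>
    first
    | (exfalso; omega)
    | (refine key 0 a b (by omega) (by omega) fun p hm hn ↦ ?_
       simp only [weylChamberB₂, hm, hn])
    | (refine key 1 (a + 2 * b) (-b) (by omega) (by omega) fun p hm hn ↦ ?_
       refine Prod.ext ?_ ?_ <;> simp only [weylChamberB₂, hm, hn] <;> omega)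
    | (refine key 2 (-a) (a + b) (by omega) (by omega) fun p hm hn ↦ ?_
       refine Prod.ext ?_ ?_ <;> simp only [weylChamberB₂, hm, hn] <;> omega)
    | (refine key 3 (-(a + 2 * b)) (a + b) (by omega) (by omega) fun p hm hn ↦ ?_
       refine Prod.ext ?_ ?_ <;> simp only [weylChamberB₂, hm, hn] <;> omega)
    | (refine key 4 (a + 2 * b) (-(a + b)) (by omega) (by omega) fun p hm hn ↦ ?_
       refine Prod.ext ?_ ?_ <;> simp only [weylChamberB₂, hm, hn] <;> omega)
    | (refine key 5 a (-(a + b)) (by omega) (by omega) fun p hm hn ↦ ?_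
       refine Prod.ext ?_ ?_ <;> simp only [weylChamberB₂, hm, hn] <;> omega)
    | (refine key 6 (-(a + 2 * b)) b (by omega) (by omega) fun p hm hn ↦ ?_
       refine Prod.ext ?_ ?_ <;> simp only [weylChamberB₂, hm, hn] <;> omega)
    | (refine key 7 (-a) (-b) (by omega) (by omega) fun p hm hn ↦ ?_
       refine Prod.ext ?_ ?_ <;> simp only [weylChamberB₂, hm, hn] <;> omega)

section

variable (s : ℂ)

lemma hurwitzFourierCoeff_natCast (n : ℕ) :
    hurwitzFourierCoeff s n = 1 / (n : ℂ) ^ s := by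
  simp [hurwitzFourierCoeff]

lemma hurwitzFourierCoeff_neg_natCast {n : ℕ} (hn : 0 < n) :
    hurwitzFourierCoeff s (-n) = exp (Real.pi * I * s) / (n : ℂ) ^ s := by
  have : ¬ (0 : ℤ) ≤ -n := by omega
  simp only [hurwitzFourierCoeff, if_neg this, Int.natAbs_neg, Int.natAbs_natCast]

/-- The lengths of the elements of the Weyl group of `B₂`. -/
def weylLengthB₂ : Fin 8 → ℕ := ![0, 1, 1, 2, 2, 3, 3, 4]

lemma hurwitzFourierCoeff_weylChamberB₂ (i : Fin 8) (p : ℕ+ × ℕ+) :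
    hurwitzFourierCoeff s (weylChamberB₂ i p).1 * hurwitzFourierCoeff s (weylChamberB₂ i p).2 *
        hurwitzFourierCoeff s ((weylChamberB₂ i p).1 + (weylChamberB₂ i p).2) *
        hurwitzFourierCoeff s ((weylChamberB₂ i p).1 + 2 * (weylChamberB₂ i p).2) =
      exp (Real.pi * I * s) ^ weylLengthB₂ i *
        (1 / (((p.1 : ℕ) : ℂ) * ((p.2 : ℕ) : ℂ) * (((p.1 : ℕ) : ℂ) + ((p.2 : ℕ) : ℂ)) *
          (((p.1 : ℕ) : ℂ) + 2 * ((p.2 : ℕ) : ℂ))) ^ s) := by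
  obtain ⟨m, n⟩ := p
  have hm := m.pos
  have hn := n.pos
  have hpow : (((m : ℕ) : ℂ) * ((n : ℕ) : ℂ) * (((m : ℕ) : ℂ) + ((n : ℕ) : ℂ)) *
      (((m : ℕ) : ℂ) + 2 * ((n : ℕ) : ℂ))) ^ s =
      ((m : ℕ) : ℂ) ^ s * ((n : ℕ) : ℂ) ^ s * ((m + n : ℕ) : ℂ) ^ s * ((m + 2 * n : ℕ) : ℂ) ^ s := by
    simp only [← natCast_mul_natCast_cpow, ← Nat.cast_mul]
    push_cast
    rfl
  simp only [hpow, weylChamberB₂]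
  generalize (m : ℕ) = m at *
  generalize (n : ℕ) = n at *
  have pos (k : ℕ) {a : ℤ} (h : a = k) : hurwitzFourierCoeff s a = 1 / (k : ℂ) ^ s :=
    h ▸ hurwitzFourierCoeff_natCast s k
  have neg (k : ℕ) (hk : 0 < k) {a : ℤ} (h : a = -k) :
      hurwitzFourierCoeff s a = exp (Real.pi * I * s) / (k : ℂ) ^ s :=
    h ▸ hurwitzFourierCoeff_neg_natCast s hk
  have h₁ {a : ℤ} := pos m (a := a)
  have h₂ {a : ℤ} := pos n (a := a)
  have h₃ {a : ℤ} := pos (m + n) (a := a)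
  have h₄ {a : ℤ} := pos (m + 2 * n) (a := a)
  have h₁' {a : ℤ} := neg m hm (a := a)
  have h₂' {a : ℤ} := neg n hn (a := a)
  have h₃' {a : ℤ} := neg (m + n) (by omega) (a := a)
  have h₄' {a : ℤ} := neg (m + 2 * n) (by omega) (a := a)
  generalize (m : ℂ) ^ s = A at *
  generalize (n : ℂ) ^ s = B at *
  generalize ((m + n : ℕ) : ℂ) ^ s = C at *
  generalize ((m + 2 * n : ℕ) : ℂ) ^ s = D at *
  generalize exp (Real.pi * I * s) = E at *
  fin_cases i <;> simp only [weylLengthB₂]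
  · rw [h₁ (by omega), h₂ (by omega), h₃ (by omega), h₄ (by omega)]
    simp
    ring
  · rw [h₄ (by omega), h₂' (by omega), h₃ (by omega), h₁ (by omega)]
    simp
    ring
  · rw [h₁' (by omega), h₃ (by omega), h₂ (by omega), h₄ (by omega)]
    simp
    ring
  · rw [h₄ (by omega), h₃' (by omega), h₂ (by omega), h₁' (by omega)]
    simp
    ring
  · rw [h₄' (by omega), h₃ (by omega), h₂' (by omega), h₁ (by omega)]
    simp
    ring
  · rw [h₁ (by omega), h₃' (by omega), h₂' (by omega), h₄' (by omega)]
    simp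
    ring
  · rw [h₄' (by omega), h₂ (by omega), h₃' (by omega), h₁' (by omega)]
    simp
    ring
  · rw [h₁' (by omega), h₂' (by omega), h₃' (by omega), h₄' (by omega)]
    simp
    ring

end

/-- Integral representation for the Witten zeta function of `B₂`:
for `Re(s) > 1`,
`(1 + 2e^{iπs} + 2e^{2iπs} + 2e^{3iπs} + e^{4iπs}) Σ_{m,n≥1} (mn(m+n)(m+2n))^{-s}
  = ((2πi)^s/Γ(s))⁴ ∫_{[0,1]²} ζ(1-s,x₁)ζ(1-s,x₂)ζ(1-s,-x₁-2x₂)ζ(1-s,-x₁-x₂) dx`. -/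
theorem stmt_5 (s : ℂ) (hs : 1 < s.re) :
    (1 + 2 * Complex.exp (Real.pi * I * s) + 2 * Complex.exp (2 * Real.pi * I * s) +
        2 * Complex.exp (3 * Real.pi * I * s) + Complex.exp (4 * Real.pi * I * s)) *
      ∑' p : ℕ+ × ℕ+, 1 / (((p.1 : ℕ) : ℂ) * ((p.2 : ℕ) : ℂ) *
        (((p.1 : ℕ) : ℂ) + ((p.2 : ℕ) : ℂ)) *
        (((p.1 : ℕ) : ℂ) + 2 * ((p.2 : ℕ) : ℂ))) ^ s =
    ((2 * Real.pi * I) ^ s / Complex.Gamma s) ^ 4 *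
      ∫ x in (Set.Ioo (0 : ℝ) 1 ×ˢ Set.Ioo (0 : ℝ) 1),
        hurwitzZeta (x.1 : UnitAddCircle) (1 - s) *
          hurwitzZeta (x.2 : UnitAddCircle) (1 - s) *
          hurwitzZeta ((-x.1 - 2 * x.2 : ℝ) : UnitAddCircle) (1 - s) *
          hurwitzZeta ((-x.1 - x.2 : ℝ) : UnitAddCircle) (1 - s) := by
  have hs0 : s ≠ 0 := by rintro rfl; norm_num at hs
  have hsum := setIntegral_fourier_B₂ (summable_norm_hurwitzFourierCoeff hs)
    (hasSum_hurwitzFourierCoeff hs)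
  have h0 : hurwitzFourierCoeff s 0 = 0 := by simp [hurwitzFourierCoeff, hs0]
  rw [← integral_const_mul]
  convert! hsum.tsum_eq using 1
  · rw [← injective_weylChamberB₂.tsum_eq]
    · have hsumm := hsum.summable.comp_injective injective_weylChamberB₂
      simp only [Function.comp_def, hurwitzFourierCoeff_weylChamberB₂] at hsumm
      simp only [hurwitzFourierCoeff_weylChamberB₂]
      rw [hsumm.tsum_prod]
      simp only [tsum_mul_left, tsum_fintype, ← Finset.sum_mul]
      congr 1
      have hexp (k : ℕ) : exp (k * Real.pi * I * s) = exp (Real.pi * I * s) ^ k := by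
        rw [← Complex.exp_nat_mul]
        ring_nf
      have h₂ := hexp 2
      have h₃ := hexp 3
      have h₄ := hexp 4
      push_cast at h₂ h₃ h₄
      rw [h₂, h₃, h₄]
      simp [Fin.sum_univ_eight, weylLengthB₂]
      ring
    · rintro ⟨a, b⟩ h
      apply mem_range_weylChamberB₂ <;> intro h' <;> simp [h', h0] at h
  · congr 1 with x
    ring
end

section
/- There exists a function F : ℂ → ℂ, meromorphic on all of ℂ, such that F(s) = Σ_{m,n ≥ 1} 1/(m·n·(m+n))^s for every s with Re(s) > 1 (sum over all pairs of positive integers), and such that for every positive integer k: F is analytic at s = −2k with F(−2k) = 0 and F′(−2k) = 0 (a zero of order at least 2), and F is analytic at s = −(2k−1) with F(−(2k−1)) = 0 (a zero of order at least 1). -/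
open Complex

section

open MeasureTheory Set Filter Topology Metric

/-- A compact integral of a jointly continuous family of holomorphic functions is holomorphic. -/
theorem differentiableOn_intervalIntegral_param {U : Set ℂ} (hU : IsOpen U) {a b : ℝ}
    (hab : a ≤ b) {Φ : ℂ → ℝ → ℂ}
    (hc : ContinuousOn (fun q : ℂ × ℝ => Φ q.1 q.2) (U ×ˢ Icc a b))
    (hd : ∀ t ∈ Icc a b, DifferentiableOn ℂ (fun s => Φ s t) U) :
    DifferentiableOn ℂ (fun s => ∫ t in a..b, Φ s t) U := by
  intro s₀ hs₀
  obtain ⟨ε, hε, hball⟩ := Metric.isOpen_iff.1 hU s₀ hs₀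
  set r := ε / 3 with hr
  have hr0 : 0 < r := by positivity
  have hsub : closedBall s₀ (2 * r) ⊆ U :=
    (closedBall_subset_ball (by rw [hr]; linarith)).trans hball
  obtain ⟨M, hM⟩ := ((isCompact_closedBall s₀ (2 * r)).prod (isCompact_Icc (a := a) (b := b)))
    |>.exists_bound_of_continuousOn (hc.mono (prod_mono hsub le_rfl))
  have hslice : ∀ s ∈ U, ContinuousOn (Φ s) (Icc a b) := fun s hs =>
    hc.comp (f := fun t : ℝ => (s, t)) (by fun_prop) fun t ht => ⟨hs, ht⟩
  have hmeas : ∀ s ∈ U, AEStronglyMeasurable (Φ s) (volume.restrict (uIoc a b)) := fun s hs => by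
    rw [uIoc_of_le hab]
    exact ((hslice s hs).mono Ioc_subset_Icc_self).aestronglyMeasurable measurableSet_Ioc
  have hder : ∀ t ∈ uIoc a b, ∀ s ∈ U, HasDerivAt (fun s => Φ s t) (deriv (fun s => Φ s t) s) s :=
    fun t ht s hs => by
      rw [uIoc_of_le hab] at ht
      exact ((hd t (Ioc_subset_Icc_self ht)).differentiableAt (hU.mem_nhds hs)).hasDerivAt
  have hballU : ball s₀ r ⊆ U := (ball_subset_closedBall.trans
    (closedBall_subset_closedBall (by linarith))).trans hsub
  refine (intervalIntegral.hasDerivAt_integral_of_dominated_loc_of_deriv_le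
    (F := Φ) (F' := fun s t => deriv (fun s => Φ s t) s) (bound := fun _ => M / r)
    (ball_mem_nhds s₀ hr0) ?_ ?_ ?_ ?_ ?_ ?_).2.differentiableAt.differentiableWithinAt
  · filter_upwards [hU.mem_nhds hs₀] with s hs using hmeas s hs
  · exact ContinuousOn.intervalIntegrable (by rw [uIcc_of_le hab]; exact hslice s₀ hs₀)
  · have hlim : Tendsto (fun n : ℕ => s₀ + (r / ((n : ℝ) + 1) : ℝ)) atTop (𝓝[≠] s₀) := by
      refine tendsto_nhdsWithin_iff.2 ⟨?_, Eventually.of_forall fun n => ?_⟩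
      · have h0 : Tendsto (fun n : ℕ => r / ((n : ℝ) + 1)) atTop (𝓝 0) := by
          simpa [div_eq_mul_inv] using
            (tendsto_one_div_add_atTop_nhds_zero_nat (𝕜 := ℝ)).const_mul r
        simpa using ((continuous_ofReal.tendsto 0).comp h0).const_add s₀
      · have : (r / ((n : ℝ) + 1)) ≠ 0 := by positivity
        simp only [mem_compl_iff, mem_singleton_iff, add_eq_left, ofReal_eq_zero]
        exact this
    refine aestronglyMeasurable_of_tendsto_ae atTop
      (f := fun (n : ℕ) t => slope (fun s => Φ s t) s₀ (s₀ + (r / ((n : ℝ) + 1) : ℝ))) (fun n => ?_) ?_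
    · simp only [slope_def_field]
      have : s₀ + (r / ((n : ℝ) + 1) : ℝ) ∈ U := by
        refine hsub ?_
        rw [mem_closedBall, dist_eq_norm, add_sub_cancel_left, norm_real, Real.norm_eq_abs,
          abs_of_pos (by positivity)]
        refine (div_le_self hr0.le (by linarith [n.cast_nonneg (α := ℝ)])).trans (by linarith)
      simp only [div_eq_mul_inv _ (_ - s₀)]
      exact ((hmeas _ this).sub (hmeas _ hs₀)).mul_const _
    · filter_upwards [ae_restrict_mem measurableSet_uIoc] with t ht
      exact (hasDerivAt_iff_tendsto_slope.1 (hder t ht s₀ hs₀)).comp hlim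
  · refine Eventually.of_forall fun t ht s hs => ?_
    have ht' : t ∈ Icc a b := by rw [uIoc_of_le hab] at ht; exact Ioc_subset_Icc_self ht
    have hs' : closedBall s r ⊆ closedBall s₀ (2 * r) :=
      closedBall_subset_closedBall' (by have := mem_ball.1 hs; linarith)
    refine norm_deriv_le_of_forall_mem_sphere_norm_le hr0 ?_ fun z hz =>
      hM (z, t) ⟨hs' (sphere_subset_closedBall hz), ht'⟩
    exact ((hd t ht').mono (hs'.trans hsub)).diffContOnCl_ball le_rfl
  · exact intervalIntegrable_const
  · exact Eventually.of_forall fun t ht s hs => hder t ht s (hballU hs)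

/-- Replacing an integral along a segment ending at a branch point by one over a circle. -/
theorem exp_sub_one_mul_integral_cpow_mul {G : ℂ → ℂ} {ρ : ℝ} (hρ : 1 / 2 < ρ)
    (hG : DifferentiableOn ℂ G (ball 0 ρ)) {w : ℂ} (hw : 0 ≤ w.re) :
    (exp (2 * Real.pi * I * w) - 1) * ∫ x in (0 : ℝ)..(1 / 2), (x : ℂ) ^ w * G x =
      ∫ θ in (0 : ℝ)..(2 * Real.pi),
        I * exp ((w + 1) * (-Real.log 2 + θ * I)) * G (exp (-Real.log 2 + θ * I)) := by
  set c : ℕ → ℂ := fun n => (n.factorial : ℂ)⁻¹ * iteratedDeriv n G 0 with hc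
  have hsum : ∀ x ∈ ball (0 : ℂ) ρ, HasSum (fun n => c n * x ^ n) (G x) := fun x hx => by
    refine (Complex.hasSum_taylorSeries_on_ball hG hx).congr_fun fun n => ?_
    simp only [smul_eq_mul, sub_zero, hc]; ring
  have hhalf : Summable fun n => ‖c n‖ * (1 / 2 : ℝ) ^ n := by
    have := (hsum (1 / 2 : ℂ) (by simpa using hρ)).summable.norm
    simpa [norm_mul, norm_pow] using this
  have hexp : ∀ θ : ℝ, ‖exp (-Real.log 2 + θ * I)‖ = 1 / 2 := fun θ => by
    have : (-(Real.log 2 : ℂ) + θ * I).re = -Real.log 2 := by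
      simp only [add_re, neg_re, ofReal_re, mul_re, I_re, I_im, ofReal_im]; ring
    rw [norm_exp, this, Real.exp_neg, Real.exp_log two_pos, one_div]
  have hlhs : HasSum (fun n => ∫ x in (0 : ℝ)..(1 / 2), (x : ℂ) ^ w * (c n * (x : ℂ) ^ n))
      (∫ x in (0 : ℝ)..(1 / 2), (x : ℂ) ^ w * G x) := by
    refine intervalIntegral.hasSum_integral_of_dominated_convergence
      (fun n _ => ‖c n‖ * (1 / 2 : ℝ) ^ n) (fun n => ?_) (fun n => ?_) ?_ ?_ ?_
    · rw [uIoc_of_le (by norm_num)]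
      refine ContinuousOn.aestronglyMeasurable (fun x hx => ?_) measurableSet_Ioc
      have : ContinuousAt (fun x : ℝ => (x : ℂ) ^ w) x :=
        continuousAt_ofReal_cpow_const _ _ (Or.inr hx.1.ne')
      exact (this.mul (by fun_prop)).continuousWithinAt
    · refine Eventually.of_forall fun x hx => ?_
      rw [uIoc_of_le (by norm_num)] at hx
      rw [norm_mul, norm_mul, norm_pow, norm_real, Real.norm_eq_abs, abs_of_pos hx.1,
        norm_cpow_eq_rpow_re_of_pos hx.1]
      have h1 : x ^ w.re ≤ 1 := Real.rpow_le_one hx.1.le (by linarith [hx.2]) hw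
      have h2 : x ^ n ≤ (1 / 2 : ℝ) ^ n := pow_le_pow_left₀ hx.1.le hx.2 n
      calc x ^ w.re * (‖c n‖ * x ^ n) ≤ 1 * (‖c n‖ * (1 / 2 : ℝ) ^ n) := by
            have := hx.1.le
            gcongr
        _ = _ := one_mul _
    · exact Eventually.of_forall fun x _ => hhalf
    · exact intervalIntegrable_const
    · refine Eventually.of_forall fun x hx => (hsum x ?_).mul_left _
      rw [uIoc_of_le (by norm_num)] at hx
      simp only [mem_ball, dist_zero_right, norm_real, Real.norm_eq_abs, abs_of_pos hx.1]
      linarith [hx.2]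
  have hrhs : HasSum (fun n => ∫ θ in (0 : ℝ)..(2 * Real.pi),
        I * exp ((w + 1) * (-Real.log 2 + θ * I)) * (c n * exp (-Real.log 2 + θ * I) ^ n))
      (∫ θ in (0 : ℝ)..(2 * Real.pi),
        I * exp ((w + 1) * (-Real.log 2 + θ * I)) * G (exp (-Real.log 2 + θ * I))) := by
    obtain ⟨B, hB⟩ := (isCompact_uIcc (a := (0 : ℝ)) (b := 2 * Real.pi)).exists_bound_of_continuousOn
      (f := fun θ : ℝ => I * exp ((w + 1) * (-Real.log 2 + θ * I))) (by fun_prop)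
    refine intervalIntegral.hasSum_integral_of_dominated_convergence
      (fun n _ => B * (‖c n‖ * (1 / 2 : ℝ) ^ n)) (fun n => ?_) (fun n => ?_) ?_ ?_ ?_
    · exact (by fun_prop : Continuous _).aestronglyMeasurable
    · refine Eventually.of_forall fun θ hθ => ?_
      rw [norm_mul, norm_mul (c n), norm_pow, hexp]
      exact mul_le_mul_of_nonneg_right (hB θ (uIoc_subset_uIcc hθ)) (by positivity)
    · exact Eventually.of_forall fun x _ => hhalf.mul_left B
    · exact intervalIntegrable_const
    · refine Eventually.of_forall fun θ _ => (hsum _ ?_).mul_left _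
      rwa [mem_ball, dist_zero_right, hexp]
  refine (hlhs.mul_left _).unique (hrhs.congr_fun fun n => ?_)
  have hne : w + 1 + n ≠ 0 := fun h => by
    have := congrArg re h
    simp at this
    linarith [n.cast_nonneg (α := ℝ)]
  have h1 : ∫ x in (0 : ℝ)..(1 / 2), (x : ℂ) ^ w * (c n * (x : ℂ) ^ n) =
      c n * (exp ((w + 1 + n) * -Real.log 2) / (w + 1 + n)) := by
    have h3 : ∫ x in (0 : ℝ)..(1 / 2), (x : ℂ) ^ w * (c n * (x : ℂ) ^ n) =
        ∫ x in (0 : ℝ)..(1 / 2), c n * (x : ℂ) ^ (w + n) := by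
      refine intervalIntegral.integral_congr_ae (Eventually.of_forall fun x hx => ?_)
      rw [uIoc_of_le (by norm_num)] at hx
      rw [cpow_add _ _ (ofReal_ne_zero.2 hx.1.ne'), cpow_natCast]
      ring
    have hre : -1 < (w + n).re := by
      simp only [add_re, natCast_re]
      linarith [n.cast_nonneg (α := ℝ)]
    rw [h3, intervalIntegral.integral_const_mul, integral_cpow (Or.inl hre),
      show w + n + 1 = w + 1 + n by ring, ofReal_zero, zero_cpow hne, sub_zero,
      cpow_def_of_ne_zero (by norm_num), ← ofReal_log (by norm_num), one_div, Real.log_inv,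
      ofReal_neg, mul_comm (-(Real.log 2 : ℂ))]
  have h2 : ∫ θ in (0 : ℝ)..(2 * Real.pi),
        I * exp ((w + 1) * (-Real.log 2 + θ * I)) * (c n * exp (-Real.log 2 + θ * I) ^ n) =
      c n * exp ((w + 1 + n) * -Real.log 2) * I *
        ((exp ((w + 1 + n) * I * (2 * Real.pi)) - 1) / ((w + 1 + n) * I)) := by
    have h3 := integral_exp_mul_complex (a := 0) (b := 2 * Real.pi) (mul_ne_zero hne I_ne_zero)
    simp only [ofReal_mul, ofReal_ofNat, ofReal_zero, mul_zero, exp_zero] at h3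
    rw [← h3, ← intervalIntegral.integral_const_mul]
    refine intervalIntegral.integral_congr fun θ _ => ?_
    simp only [← exp_nat_mul]
    have : exp ((w + 1) * (-Real.log 2 + θ * I)) * exp (n * (-Real.log 2 + θ * I)) =
      exp ((w + 1 + n) * -Real.log 2) * exp ((w + 1 + n) * I * θ) := by
      rw [← exp_add, ← exp_add]; congr 1; ring
    linear_combination I * c n * this
  have h4 : exp ((w + 1 + n) * I * (2 * Real.pi)) = exp (2 * Real.pi * I * w) := by
    rw [show (w + 1 + n) * I * (2 * Real.pi) = 2 * Real.pi * I * w + ((n + 1 : ℕ) : ℂ) * (2 * Real.pi * I) by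
      push_cast; ring, exp_add, exp_nat_mul_two_pi_mul_I, mul_one]
  rw [h1, h2, h4]
  field_simp

/-- A function of `s ∈ U` and `|x| < 3/4` that is jointly continuous and separately holomorphic. -/
structure IsHolomorphicKernel (U : Set ℂ) (G : ℂ → ℂ → ℂ) : Prop where
  continuousOn : ContinuousOn (fun q : ℂ × ℂ => G q.1 q.2) (U ×ˢ ball 0 (3 / 4))
  left : ∀ x ∈ ball (0 : ℂ) (3 / 4), DifferentiableOn ℂ (fun s => G s x) U
  right : ∀ s ∈ U, DifferentiableOn ℂ (G s) (ball 0 (3 / 4))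

namespace IsHolomorphicKernel

variable {U : Set ℂ} {G H : ℂ → ℂ → ℂ}

theorem add (hG : IsHolomorphicKernel U G) (hH : IsHolomorphicKernel U H) :
    IsHolomorphicKernel U fun s x => G s x + H s x :=
  ⟨hG.1.add hH.1, fun x hx => (hG.2 x hx).add (hH.2 x hx), fun s hs => (hG.3 s hs).add (hH.3 s hs)⟩

theorem mul (hG : IsHolomorphicKernel U G) (hH : IsHolomorphicKernel U H) :
    IsHolomorphicKernel U fun s x => G s x * H s x :=
  ⟨hG.1.mul hH.1, fun x hx => (hG.2 x hx).mul (hH.2 x hx), fun s hs => (hG.3 s hs).mul (hH.3 s hs)⟩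

theorem of_left {f : ℂ → ℂ} (hf : DifferentiableOn ℂ f U) :
    IsHolomorphicKernel U fun s _ => f s :=
  ⟨hf.continuousOn.comp continuousOn_fst fun _ hq => hq.1, fun _ _ => hf,
    fun _ _ => differentiableOn_const _⟩

theorem of_right {f : ℂ → ℂ} (hf : DifferentiableOn ℂ f (ball 0 (3 / 4))) :
    IsHolomorphicKernel U fun _ x => f x :=
  ⟨hf.continuousOn.comp continuousOn_snd fun _ hq => hq.2, fun _ _ => differentiableOn_const _,
    fun _ _ => hf⟩

theorem comp_neg (hG : IsHolomorphicKernel U G) : IsHolomorphicKernel U fun s x => G s (-x) := by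
  have hmem : ∀ x ∈ ball (0 : ℂ) (3 / 4), -x ∈ ball (0 : ℂ) (3 / 4) := fun x hx => by
    simpa using hx
  exact ⟨hG.1.comp (f := fun q : ℂ × ℂ => (q.1, -q.2)) (by fun_prop)
      fun q hq => ⟨hq.1, hmem _ hq.2⟩, fun x hx => hG.2 _ (hmem x hx),
    fun s hs => (hG.3 s hs).comp differentiable_neg.differentiableOn hmem⟩

end IsHolomorphicKernel

/-- `f` is meromorphic at `z` with at most a simple pole. -/
def HasAtMostSimplePole (f : ℂ → ℂ) (z : ℂ) : Prop :=
  MeromorphicAt f z ∧ -1 ≤ meromorphicOrderAt f z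

theorem HasAtMostSimplePole.add {f g : ℂ → ℂ} {z : ℂ} (hf : HasAtMostSimplePole f z)
    (hg : HasAtMostSimplePole g z) : HasAtMostSimplePole (f + g) z :=
  ⟨hf.1.add hg.1, (le_min hf.2 hg.2).trans (meromorphicOrderAt_add hf.1 hg.1)⟩

theorem AnalyticAt.hasAtMostSimplePole {f : ℂ → ℂ} {z : ℂ} (hf : AnalyticAt ℂ f z) :
    HasAtMostSimplePole f z :=
  ⟨hf.meromorphicAt, (by decide : (-1 : WithTop ℤ) ≤ 0).trans hf.meromorphicOrderAt_nonneg⟩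

theorem HasAtMostSimplePole.mul_analyticAt {f g : ℂ → ℂ} {z : ℂ} (hf : HasAtMostSimplePole f z)
    (hg : AnalyticAt ℂ g z) : HasAtMostSimplePole (f * g) z := by
  refine ⟨hf.1.mul hg.meromorphicAt, ?_⟩
  rw [meromorphicOrderAt_mul hf.1 hg.meromorphicAt]
  simpa using add_le_add hf.2 hg.meromorphicOrderAt_nonneg

theorem hasAtMostSimplePole_inv_exp_sub_one {α β : ℂ} (hα : α ≠ 0) (z : ℂ) :
    HasAtMostSimplePole (fun s => exp (α * s + β) - 1)⁻¹ z := by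
  have han : AnalyticAt ℂ (fun s => exp (α * s + β) - 1) z := by fun_prop
  refine ⟨han.meromorphicAt.inv, ?_⟩
  rw [meromorphicOrderAt_inv, han.meromorphicOrderAt_eq]
  by_cases h : exp (α * z + β) = 1
  · have hd : HasDerivAt (fun s => exp (α * s + β)) (exp (α * z + β) * α) z := by
      simpa using (((hasDerivAt_id z).const_mul α).add_const β).cexp
    have := AnalyticAt.analyticOrderAt_sub_eq_one_of_deriv_ne_zero
      (f := fun s => exp (α * s + β)) (x := z) (by fun_prop)
      (by rw [hd.deriv]; exact mul_ne_zero (exp_ne_zero _) hα)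
    rw [h] at this
    rw [this]
    rfl
  · rw [han.analyticOrderAt_eq_zero.2 (sub_ne_zero.2 h)]
    decide

theorem exists_hasAtMostSimplePole_integral {U : Set ℂ} (hU : IsOpen U) {G : ℂ → ℂ → ℂ}
    (hG : IsHolomorphicKernel U G) (p : ℕ) :
    ∃ J : ℂ → ℂ, (∀ z ∈ U, HasAtMostSimplePole J z) ∧
      ∀ s ∈ U, 1 < s.re → p * (s.re - 1) < 1 →
        J s = ∫ x in (0 : ℝ)..(1 / 2), ((x : ℂ) ^ (s - 1)) ^ p * G s x := by
  obtain rfl | hp := Nat.eq_zero_or_pos p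
  · refine ⟨fun s => ∫ x in (0 : ℝ)..(1 / 2), G s x, fun z hz => ?_, fun s _ _ _ => by simp⟩
    have hmem : ∀ x ∈ Icc (0 : ℝ) (1 / 2), (x : ℂ) ∈ ball (0 : ℂ) (3 / 4) := fun x hx => by
      rw [mem_ball, dist_zero_right, norm_real, Real.norm_eq_abs, abs_of_nonneg hx.1]
      linarith [hx.2]
    refine ((differentiableOn_intervalIntegral_param hU (by norm_num) ?_ fun t ht =>
      hG.left _ (hmem t ht)).analyticAt (hU.mem_nhds hz)).hasAtMostSimplePole
    exact hG.continuousOn.comp (f := fun q : ℂ × ℝ => (q.1, (q.2 : ℂ))) (by fun_prop)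
      fun q hq => ⟨hq.1, hmem _ hq.2⟩
  have hp' : (p : ℂ) ≠ 0 := by exact_mod_cast hp.ne'
  have hmem : ∀ θ : ℝ, exp (-Real.log 2 + θ * I) ∈ ball (0 : ℂ) (3 / 4) := fun θ => by
    have : (-(Real.log 2 : ℂ) + θ * I).re = -Real.log 2 := by
      simp only [add_re, neg_re, ofReal_re, mul_re, I_re, I_im, ofReal_im]; ring
    rw [mem_ball, dist_zero_right, norm_exp, this, Real.exp_neg, Real.exp_log two_pos]
    norm_num
  refine ⟨(fun s => exp (2 * Real.pi * I * p * s + -(2 * Real.pi * I * p)) - 1)⁻¹ *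
    fun s => ∫ θ in (0 : ℝ)..(2 * Real.pi), I * exp ((p * (s - 1) + 1) * (-Real.log 2 + θ * I)) *
      G s (exp (-Real.log 2 + θ * I)), fun z hz => ?_, fun s hs h1 h2 => ?_⟩
  · refine (hasAtMostSimplePole_inv_exp_sub_one
      (mul_ne_zero two_pi_I_ne_zero hp') z).mul_analyticAt ?_
    refine (differentiableOn_intervalIntegral_param hU (by positivity) ?_ fun θ _ => ?_).analyticAt
      (hU.mem_nhds hz)
    · refine ContinuousOn.mul (by fun_prop) ?_
      exact hG.continuousOn.comp (f := fun q : ℂ × ℝ => (q.1, exp (-Real.log 2 + q.2 * I)))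
        (by fun_prop) fun q hq => ⟨hq.1, hmem _⟩
    · exact DifferentiableOn.mul (by fun_prop) (hG.left _ (hmem θ))
  · have hre : ((p : ℂ) * (s - 1)).re = p * (s.re - 1) := by simp
    have hpos : 0 < ((p : ℂ) * (s - 1)).re := by
      rw [hre]; exact mul_pos (by exact_mod_cast hp) (by linarith)
    have hmain := exp_sub_one_mul_integral_cpow_mul (by norm_num) (hG.right s hs) hpos.le
    have hne : exp (2 * Real.pi * I * (p * (s - 1))) - 1 ≠ 0 := by
      intro h
      obtain ⟨n, hn⟩ := exp_eq_one_iff.1 (sub_eq_zero.1 h)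
      have : (p : ℂ) * (s - 1) = n := by
        apply mul_left_cancel₀ two_pi_I_ne_zero
        rw [hn]; ring
      rw [this, intCast_re] at hre
      rw [this, intCast_re] at hpos
      rw [← hre] at h2
      have h3 : 0 < n := by exact_mod_cast hpos
      have h4 : n < 1 := by exact_mod_cast h2
      omega
    have hpow : ∀ x : ℂ, (x ^ (s - 1)) ^ p = x ^ (p * (s - 1)) := fun x => by
      rw [← cpow_nat_mul]
    simp only [hpow, Pi.mul_apply, Pi.inv_apply]
    rw [← hmain, show 2 * Real.pi * I * p * s + -(2 * Real.pi * I * p) =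
      2 * Real.pi * I * (p * (s - 1)) by ring, inv_mul_cancel_left₀ hne]

theorem exists_hasAtMostSimplePole_integral_sq_mul {U : Set ℂ} (hU : IsOpen U) {a b : ℂ → ℂ → ℂ}
    (ha : IsHolomorphicKernel U a) (hb : IsHolomorphicKernel U b) :
    ∃ J : ℂ → ℂ, (∀ z ∈ U, HasAtMostSimplePole J z) ∧
      ∀ s ∈ U, 1 < s.re → s.re < 4 / 3 →
        J s = ∫ x in (0 : ℝ)..(1 / 2), (s / 2 * (x : ℂ) ^ (s - 1) + a s x) ^ 2 *
          (s / 2 * (x : ℂ) ^ (s - 1) + b s x) := by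
  have hs (n : ℕ) : IsHolomorphicKernel U fun s _ => (s / 2) ^ n := .of_left (by fun_prop)
  have h2 : IsHolomorphicKernel U fun _ _ => 2 := .of_left (by fun_prop)
  have k3 := hs 3
  have k2 := (hs 2).mul ((h2.mul ha).add hb)
  have k1 := (hs 1).mul ((ha.mul ha).add (h2.mul (ha.mul hb)))
  have k0 := (ha.mul ha).mul hb
  obtain ⟨J₃, p₃, e₃⟩ := exists_hasAtMostSimplePole_integral hU k3 3
  obtain ⟨J₂, p₂, e₂⟩ := exists_hasAtMostSimplePole_integral hU k2 2
  obtain ⟨J₁, p₁, e₁⟩ := exists_hasAtMostSimplePole_integral hU k1 1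
  obtain ⟨J₀, p₀, e₀⟩ := exists_hasAtMostSimplePole_integral hU k0 0
  refine ⟨J₃ + J₂ + J₁ + J₀,
    fun z hz => (((p₃ z hz).add (p₂ z hz)).add (p₁ z hz)).add (p₀ z hz), fun s hs h1 h43 => ?_⟩
  have hintegral (p : ℕ) {G : ℂ → ℂ → ℂ} (hG : IsHolomorphicKernel U G) :
      IntervalIntegrable (fun x : ℝ => ((x : ℂ) ^ (s - 1)) ^ p * G s x) volume 0 (1 / 2) := by
    refine ContinuousOn.intervalIntegrable (ContinuousOn.mul ?_ ?_)
    · exact ((continuous_ofReal_cpow_const (by simpa using h1)).pow p).continuousOn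
    · refine (hG.right s hs).continuousOn.comp continuous_ofReal.continuousOn fun x hx => ?_
      rw [uIcc_of_le (by norm_num)] at hx
      rw [mem_ball, dist_zero_right, norm_real, Real.norm_eq_abs, abs_of_nonneg hx.1]
      linarith [hx.2]
  simp only [Pi.add_apply]
  rw [e₃ s hs h1 (by push_cast; linarith), e₂ s hs h1 (by push_cast; linarith),
    e₁ s hs h1 (by push_cast; linarith), e₀ s hs h1 (by push_cast; linarith),
    ← intervalIntegral.integral_add (hintegral 3 k3) (hintegral 2 k2),
    ← intervalIntegral.integral_add ((hintegral 3 k3).add (hintegral 2 k2)) (hintegral 1 k1),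
    ← intervalIntegral.integral_add (((hintegral 3 k3).add (hintegral 2 k2)).add (hintegral 1 k1)) (hintegral 0 k0)]
  refine intervalIntegral.integral_congr fun x _ => ?_
  ring

theorem IsHolomorphicKernel.of_forall_exists {U : Set ℂ} {G : ℂ → ℂ → ℂ}
    (h : ∀ s ∈ U, ∃ V, IsOpen V ∧ s ∈ V ∧ IsHolomorphicKernel V G) : IsHolomorphicKernel U G := by
  refine ⟨fun q hq => ?_, fun x hx s hs => ?_, fun s hs => ?_⟩
  · obtain ⟨V, hV, hs, hG⟩ := h q.1 hq.1
    exact (hG.continuousOn.continuousAt ((hV.prod isOpen_ball).mem_nhds ⟨hs, hq.2⟩)).continuousWithinAt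
  · obtain ⟨V, hV, hs, hG⟩ := h s hs
    exact ((hG.left x hx).differentiableAt (hV.mem_nhds hs)).differentiableWithinAt
  · obtain ⟨V, hV, hs, hG⟩ := h s hs
    exact hG.right s hs

theorem one_add_mem_slitPlane_of_mem_ball {y : ℂ} (hy : y ∈ ball (0 : ℂ) (3 / 4)) :
    1 + y ∈ slitPlane :=
  mem_slitPlane_of_norm_lt_one (by rw [mem_ball, dist_zero_right] at hy; linarith)

theorem exists_norm_one_add_cpow_sub_le (R : ℝ) :
    ∃ K : ℝ, ∀ a : ℂ, ‖a‖ ≤ R → ∀ y ∈ ball (0 : ℂ) (3 / 4),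
      ‖(1 + y) ^ a - 1 - a * y‖ ≤ K * ‖y‖ ^ 2 := by
  obtain hR | hR := lt_or_ge R 0
  · exact ⟨0, fun a ha => absurd ha (by linarith [norm_nonneg a])⟩
  have hslit : ∀ y ∈ closedBall (0 : ℂ) (3 / 4), 1 + y ∈ slitPlane := fun y hy =>
    mem_slitPlane_of_norm_lt_one (by rw [mem_closedBall, dist_zero_right] at hy; linarith)
  obtain ⟨M, hM⟩ := ((isCompact_closedBall (0 : ℂ) R).prod
    (isCompact_closedBall (0 : ℂ) (3 / 4))).exists_bound_of_continuousOn
    (f := fun q : ℂ × ℂ => (1 + q.2) ^ (q.1 - 2))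
    (ContinuousOn.cpow (by fun_prop) (by fun_prop) fun q hq => hslit _ hq.2)
  have hder (b : ℂ) (y : ℂ) (hy : y ∈ ball (0 : ℂ) (3 / 4)) :
      HasDerivAt (fun y => (1 + y) ^ b) (b * (1 + y) ^ (b - 1)) y := by
    simpa using ((hasDerivAt_id y).const_add 1).cpow_const (c := b) (one_add_mem_slitPlane_of_mem_ball hy)
  have hM0 : 0 ≤ M := (norm_nonneg _).trans (hM (0, 0) ⟨by simpa using hR, by norm_num⟩)
  refine ⟨R * ((R + 1) * M), fun a ha y hy => ?_⟩
  have hsub : closedBall (0 : ℂ) ‖y‖ ⊆ ball 0 (3 / 4) :=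
    closedBall_subset_ball (by simpa using hy)
  have h0 : ∀ r : ℝ, 0 ≤ r → (0 : ℂ) ∈ closedBall (0 : ℂ) r := fun r hr => mem_closedBall_self hr
  have first : ∀ z ∈ closedBall (0 : ℂ) ‖y‖, ‖(1 + z) ^ (a - 1) - 1‖ ≤ (R + 1) * M * ‖y‖ := by
    intro z hz
    have := (convex_closedBall (0 : ℂ) ‖y‖).norm_image_sub_le_of_norm_deriv_le
      (f := fun z => (1 + z) ^ (a - 1)) (C := (R + 1) * M)
      (fun u hu => (hder _ u (hsub hu)).differentiableAt) (fun u hu => ?_) (h0 _ (norm_nonneg y)) hz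
    · simp only [add_zero, one_cpow, sub_zero] at this
      refine this.trans (mul_le_mul_of_nonneg_left (by simpa using hz) (by positivity))
    · rw [(hder _ u (hsub hu)).deriv, norm_mul, sub_sub, one_add_one_eq_two]
      have h1 : ‖a - 1‖ ≤ R + 1 := (norm_sub_le _ _).trans (by simpa using ha)
      have h2 := hM (a, u) ⟨by simpa using ha, ball_subset_closedBall (hsub hu)⟩
      exact mul_le_mul h1 h2 (norm_nonneg _) (by positivity)
  have hder2 : ∀ z ∈ closedBall (0 : ℂ) ‖y‖, HasDerivAt (fun z => (1 + z) ^ a - 1 - a * z)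
      (a * ((1 + z) ^ (a - 1) - 1)) z := fun z hz => by
    exact (((hder a z (hsub hz)).sub_const 1).sub ((hasDerivAt_id z).const_mul a)).congr_deriv
      (by ring)
  have := (convex_closedBall (0 : ℂ) ‖y‖).norm_image_sub_le_of_norm_deriv_le
      (f := fun z => (1 + z) ^ a - 1 - a * z) (C := R * ((R + 1) * M * ‖y‖)) (y := y)
      (fun u hu => (hder2 u hu).differentiableAt) (fun u hu => ?_) (h0 _ (norm_nonneg y)) (by simp)
  · simp only [add_zero, one_cpow, sub_zero, mul_zero, sub_self] at this
    exact this.trans_eq (by ring)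
  · rw [(hder2 u hu).deriv, norm_mul]
    exact mul_le_mul ha (first u hu) (norm_nonneg _) hR

/-- The `n`-th summand of the regularised one-sided Hurwitz series: `(n + 1 + x) ^ (s - 1)` minus
its first order Taylor polynomial in `x`. -/
noncomputable def hurwitzTaylorTerm (n : ℕ) (s x : ℂ) : ℂ :=
  ((n : ℂ) + 1) ^ (s - 1) * ((1 + x / (n + 1)) ^ (s - 1) - 1 - (s - 1) * (x / (n + 1)))

/-- The sum over `n ≥ 1` of `(n + x) ^ (s - 1)` minus its first order Taylor polynomial in `x`. -/
noncomputable def hurwitzTaylorSum (s x : ℂ) : ℂ := ∑' n, hurwitzTaylorTerm n s x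

theorem div_natCast_add_one_mem_ball {x : ℂ} (hx : x ∈ ball (0 : ℂ) (3 / 4)) (n : ℕ) :
    x / (n + 1) ∈ ball (0 : ℂ) (3 / 4) := by
  rw [mem_ball, dist_zero_right] at hx ⊢
  have : ‖(n : ℂ) + 1‖ = n + 1 := by
    rw [← Nat.cast_add_one, norm_natCast]; push_cast; rfl
  rw [norm_div, this]
  exact (div_le_self (norm_nonneg x) (by linarith [n.cast_nonneg (α := ℝ)])).trans_lt hx

theorem exists_norm_hurwitzTaylorTerm_le (R : ℝ) {ε : ℝ} (hε : 0 < ε) :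
    ∃ u : ℕ → ℝ, Summable u ∧ ∀ n : ℕ, ∀ s : ℂ, ‖s‖ < R → s.re < 2 - ε →
      ∀ x ∈ ball (0 : ℂ) (3 / 4), ‖hurwitzTaylorTerm n s x‖ ≤ u n := by
  obtain ⟨K, hK⟩ := exists_norm_one_add_cpow_sub_le (R + 1)
  refine ⟨fun n => |K| * ((n + 1 : ℕ) : ℝ) ^ (-(1 + ε)), ?_, fun n s hs hre x hx => ?_⟩
  · exact ((summable_nat_add_iff 1).2
      (Real.summable_nat_rpow.2 (by linarith : -(1 + ε) < -1))).mul_left _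
  have hn : (0 : ℝ) < ((n + 1 : ℕ) : ℝ) := by positivity
  have hn1 : (1 : ℝ) ≤ ((n + 1 : ℕ) : ℝ) := by exact_mod_cast Nat.succ_pos n
  have hnorm : ‖(n : ℂ) + 1‖ = ((n + 1 : ℕ) : ℝ) := by rw [← Nat.cast_add_one, norm_natCast]
  have hb := hK (s - 1) ((norm_sub_le _ _).trans (by simpa using hs.le)) _
    (div_natCast_add_one_mem_ball hx n)
  have hpow : ‖((n : ℂ) + 1) ^ (s - 1)‖ = ((n + 1 : ℕ) : ℝ) ^ (s.re - 1) := by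
    rw [← Nat.cast_add_one, norm_natCast_cpow_of_pos n.succ_pos]; simp
  rw [hurwitzTaylorTerm, norm_mul, hpow]
  rw [mem_ball, dist_zero_right] at hx
  have hx2 : ‖x / (n + 1)‖ ^ 2 ≤ ((n + 1 : ℕ) : ℝ) ^ (-2 : ℝ) := by
    rw [norm_div, hnorm, Real.rpow_neg hn.le, ← one_div]
    have : ((n + 1 : ℕ) : ℝ) ^ (2 : ℝ) = ((n + 1 : ℕ) : ℝ) ^ 2 := Real.rpow_two _
    rw [this, div_pow]
    gcongr
    nlinarith [norm_nonneg x]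
  calc ((n + 1 : ℕ) : ℝ) ^ (s.re - 1) * ‖(1 + x / (n + 1)) ^ (s - 1) - 1 - (s - 1) * (x / (n + 1))‖
      ≤ ((n + 1 : ℕ) : ℝ) ^ (1 - ε) * (|K| * ((n + 1 : ℕ) : ℝ) ^ (-2 : ℝ)) := by
        refine mul_le_mul (Real.rpow_le_rpow_of_exponent_le hn1 (by linarith)) ?_ (norm_nonneg _)
          (by positivity)
        exact hb.trans (mul_le_mul (le_abs_self K) hx2 (by positivity) (abs_nonneg K))
    _ = |K| * ((n + 1 : ℕ) : ℝ) ^ (-(1 + ε)) := by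
        rw [mul_left_comm, ← Real.rpow_add hn]
        congr 2; ring

theorem isHolomorphicKernel_hurwitzTaylorTerm (U : Set ℂ) (n : ℕ) :
    IsHolomorphicKernel U (hurwitzTaylorTerm n) := by
  have hn : (n : ℂ) + 1 ≠ 0 := Nat.cast_add_one_ne_zero n
  have hslit : ∀ x ∈ ball (0 : ℂ) (3 / 4), 1 + x / (n + 1) ∈ slitPlane := fun x hx =>
    one_add_mem_slitPlane_of_mem_ball (div_natCast_add_one_mem_ball hx n)
  refine ⟨?_, fun x hx => ?_, fun s _ => ?_⟩ <;> unfold hurwitzTaylorTerm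
  · have h1 : ContinuousOn (fun q : ℂ × ℂ => ((n : ℂ) + 1) ^ (q.1 - 1)) (U ×ˢ ball 0 (3 / 4)) :=
      ContinuousOn.const_cpow (by fun_prop) (Or.inl hn)
    have h2 : ContinuousOn (fun q : ℂ × ℂ => (1 + q.2 / (n + 1)) ^ (q.1 - 1))
        (U ×ˢ ball 0 (3 / 4)) :=
      ContinuousOn.cpow (by fun_prop) (by fun_prop) fun q hq => hslit _ hq.2
    fun_prop
  · have h1 : DifferentiableOn ℂ (fun s : ℂ => ((n : ℂ) + 1) ^ (s - 1)) U :=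
      DifferentiableOn.const_cpow (by fun_prop) (Or.inl hn)
    have h2 : DifferentiableOn ℂ (fun s : ℂ => (1 + x / (n + 1)) ^ (s - 1)) U :=
      DifferentiableOn.const_cpow (by fun_prop) (Or.inl (slitPlane_ne_zero (hslit x hx)))
    fun_prop
  · have h2 : DifferentiableOn ℂ (fun x : ℂ => (1 + x / (n + 1)) ^ (s - 1)) (ball 0 (3 / 4)) :=
      DifferentiableOn.cpow (by fun_prop) (by fun_prop) hslit
    fun_prop

theorem isHolomorphicKernel_hurwitzTaylorSum :
    IsHolomorphicKernel {s | s.re < 2} hurwitzTaylorSum := by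
  refine .of_forall_exists fun s₀ hs₀ => ?_
  have hs₀' : s₀.re < 2 := hs₀
  obtain ⟨u, hu, hle⟩ := exists_norm_hurwitzTaylorTerm_le (‖s₀‖ + 1) (ε := (2 - s₀.re) / 2)
    (by linarith)
  set V : Set ℂ := {s | ‖s‖ < ‖s₀‖ + 1} ∩ {s | s.re < 2 - (2 - s₀.re) / 2} with hV
  have hVo : IsOpen V :=
    (isOpen_lt continuous_norm continuous_const).inter (isOpen_lt continuous_re continuous_const)
  have hk := isHolomorphicKernel_hurwitzTaylorTerm V
  refine ⟨V, hVo, ⟨by simp, by simp only [mem_ofPred_eq]; linarith⟩, ?_, fun x hx => ?_,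
    fun s hs => ?_⟩ <;> unfold hurwitzTaylorSum
  · exact continuousOn_tsum (fun n => (hk n).continuousOn) hu
      fun n q hq => hle n q.1 hq.1.1 hq.1.2 q.2 hq.2
  · exact Complex.differentiableOn_tsum_of_summable_norm hu (fun n => (hk n).left x hx) hVo
      fun n s hs => hle n s hs.1 hs.2 x hx
  · exact Complex.differentiableOn_tsum_of_summable_norm hu (fun n => (hk n).right s hs) isOpen_ball
      fun n x hx => hle n s hs.1 hs.2 x hx

theorem summable_hurwitzTaylorTerm {s x : ℂ} (hs : s.re < 2) (hx : x ∈ ball (0 : ℂ) (3 / 4)) :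
    Summable fun n => hurwitzTaylorTerm n s x := by
  obtain ⟨u, hu, hle⟩ := exists_norm_hurwitzTaylorTerm_le (‖s‖ + 1) (ε := (2 - s.re) / 2)
    (by linarith)
  exact .of_norm_bounded hu fun n => hle n s (by linarith) (by linarith) x hx

theorem hasSum_riemannZeta_one_sub {s : ℂ} (hs : s.re < 0) :
    HasSum (fun n : ℕ => ((n : ℂ) + 1) ^ (s - 1)) (riemannZeta (1 - s)) := by
  have h1 : 1 < (1 - s).re := by rw [sub_re, one_re]; linarith
  rw [zeta_eq_tsum_one_div_nat_add_one_cpow h1]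
  have hsum : Summable fun n : ℕ => 1 / ((n : ℂ) + 1) ^ (1 - s) := by
    simpa using (summable_nat_add_iff 1).2 (Complex.summable_one_div_nat_cpow.2 h1)
  refine hsum.hasSum.congr_fun fun n => ?_
  rw [one_div, ← cpow_neg, neg_sub]

theorem hasSum_add_cpow {s : ℂ} (hs : s.re < 0) {a : ℝ} (ha : |a| < 3 / 4) :
    HasSum (fun n : ℕ => ((n : ℂ) + 1 + a) ^ (s - 1))
      (hurwitzTaylorSum s a + riemannZeta (1 - s) + (s - 1) * a * riemannZeta (2 - s)) := by
  have hmem : (a : ℂ) ∈ ball (0 : ℂ) (3 / 4) := by simpa using ha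
  have h2 := hasSum_riemannZeta_one_sub (s := s - 1) (by simp; linarith)
  rw [show 1 - (s - 1) = 2 - s by ring] at h2
  refine (((summable_hurwitzTaylorTerm (by linarith) hmem).hasSum.add
    (hasSum_riemannZeta_one_sub hs)).add (h2.mul_left ((s - 1) * a))).congr_fun fun n => ?_
  have hn : (n : ℂ) + 1 ≠ 0 := Nat.cast_add_one_ne_zero n
  have hpos : (0 : ℝ) < (n : ℝ) + 1 := by positivity
  have hnonneg : 0 ≤ 1 + a / ((n : ℝ) + 1) := by
    have h1 : -1 ≤ a := by linarith [neg_abs_le a]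
    rw [← sub_le_iff_le_add', zero_sub, le_div_iff₀ hpos]
    linarith [n.cast_nonneg (α := ℝ)]
  have hmul : ((n : ℂ) + 1 + a) ^ (s - 1) =
      ((n : ℂ) + 1) ^ (s - 1) * (1 + a / ((n : ℂ) + 1)) ^ (s - 1) := by
    have := mul_cpow_ofReal_nonneg hpos.le hnonneg (s - 1)
    push_cast at this
    rw [← this]
    congr 1
    field_simp
  have hsub : ((n : ℂ) + 1) ^ (s - 1 - 1) = ((n : ℂ) + 1) ^ (s - 1) / (n + 1) := by
    rw [cpow_sub _ 1 hn, cpow_one]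
  rw [hmul, hurwitzTaylorTerm, hsub]
  ring

theorem exists_differentiable_sub_one_mul_riemannZeta :
    ∃ E : ℂ → ℂ, Differentiable ℂ E ∧ ∀ w, w ≠ 1 → E w = (w - 1) * riemannZeta w := by
  refine ⟨fun w => (w - 1) * (riemannZeta w - 1 / (w - 1) / Gammaℝ w) + (Gammaℝ w)⁻¹,
    fun w => ?_, fun w hw => ?_⟩
  · refine ((differentiableAt_id.sub_const 1).mul ?_).add differentiable_Gammaℝ_inv.differentiableAt
    obtain rfl | hw := eq_or_ne w 1
    · exact HurwitzZeta.differentiableAt_hurwitzZetaEven_sub_one_div 0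
    · have : w - 1 ≠ 0 := sub_ne_zero.2 hw
      simp only [div_eq_mul_inv _ (Gammaℝ _)]
      exact (differentiableAt_riemannZeta hw).sub
        (DifferentiableAt.mul (by fun_prop (disch := assumption)) differentiable_Gammaℝ_inv.differentiableAt)
  · have : w - 1 ≠ 0 := sub_ne_zero.2 hw
    field_simp
    ring

theorem differentiable_hurwitzZetaEven_sub_riemannZeta (a : UnitAddCircle) :
    Differentiable ℂ fun s => HurwitzZeta.hurwitzZetaEven a (1 - s) - riemannZeta (1 - s) := by
  have h : Differentiable ℂ fun w => HurwitzZeta.hurwitzZetaEven a w - riemannZeta w := fun w => by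
    obtain rfl | hw := eq_or_ne w 1
    · have := (HurwitzZeta.differentiableAt_hurwitzZetaEven_sub_one_div a).sub
        (HurwitzZeta.differentiableAt_hurwitzZetaEven_sub_one_div 0)
      refine this.congr_of_eventuallyEq (Eventually.of_forall fun s => ?_)
      simp [HurwitzZeta.hurwitzZetaEven_zero]
    · exact (HurwitzZeta.differentiableAt_hurwitzZetaEven a hw).sub (differentiableAt_riemannZeta hw)
  exact h.comp (differentiable_id.const_sub 1)

theorem eqOn_re_lt_two_of_eqOn_re_neg {f g : ℂ → ℂ} (hf : DifferentiableOn ℂ f {s | s.re < 2})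
    (hg : DifferentiableOn ℂ g {s | s.re < 2}) (h : ∀ s : ℂ, s.re < 0 → f s = g s) :
    EqOn f g {s | s.re < 2} := by
  have ho : IsOpen {s : ℂ | s.re < 2} := isOpen_lt continuous_re continuous_const
  refine (hf.analyticOnNhd ho).eqOn_of_preconnected_of_eventuallyEq (hg.analyticOnNhd ho)
    (convex_halfSpace_re_lt 2).isPreconnected (z₀ := -1) (by norm_num) ?_
  filter_upwards [(isOpen_lt continuous_re continuous_const).mem_nhds
    (show (-1 : ℂ).re < 0 by norm_num)] with s hs using h s hs

theorem hasSum_natCast_add_cpow {s : ℂ} (hs : s.re < 0) {a : ℝ} (ha : a ∈ Ioc (0 : ℝ) (1 / 2)) :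
    HasSum (fun n : ℕ => ((n : ℂ) + a) ^ (s - 1)) ((a : ℂ) ^ (s - 1) +
      (hurwitzTaylorSum s a + riemannZeta (1 - s) + (s - 1) * a * riemannZeta (2 - s))) := by
  refine (hasSum_nat_add_iff' 1).1 ?_
  have := hasSum_add_cpow hs (a := a) (by rw [abs_of_pos ha.1]; linarith [ha.2])
  simpa using this

theorem hasSum_add_neg_cpow {s : ℂ} (hs : s.re < 0) {a : ℝ} (ha : a ∈ Ioc (0 : ℝ) (1 / 2)) :
    HasSum (fun n : ℕ => ((n : ℂ) + 1 - a) ^ (s - 1)) (hurwitzTaylorSum s (-a) +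
      riemannZeta (1 - s) - (s - 1) * a * riemannZeta (2 - s)) := by
  have := hasSum_add_cpow hs (a := -a) (by rw [abs_neg, abs_of_pos ha.1]; linarith [ha.2])
  simpa [← sub_eq_add_neg] using this

theorem differentiableOn_half_cpow_add_hurwitzTaylorSum {a : ℝ} (ha : a ∈ Ioc (0 : ℝ) (1 / 2)) (c : ℂ) :
    DifferentiableOn ℂ (fun s => ((a : ℂ) ^ (s - 1) + hurwitzTaylorSum s a +
      c * hurwitzTaylorSum s (-a)) / 2) {s | s.re < 2} := by
  have hmem : (a : ℂ) ∈ ball (0 : ℂ) (3 / 4) := by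
    simp only [mem_ball, dist_zero_right, norm_real, Real.norm_eq_abs, abs_of_pos ha.1]
    linarith [ha.2]
  have h1 := isHolomorphicKernel_hurwitzTaylorSum.left _ hmem
  have h2 := isHolomorphicKernel_hurwitzTaylorSum.left (-a) (by simpa using hmem)
  have h3 : DifferentiableOn ℂ (fun s : ℂ => (a : ℂ) ^ (s - 1)) {s | s.re < 2} :=
    DifferentiableOn.const_cpow (by fun_prop) (Or.inl (ofReal_ne_zero.2 ha.1.ne'))
  fun_prop

theorem hurwitzZetaEven_one_sub_eq {a : ℝ} (ha : a ∈ Ioc (0 : ℝ) (1 / 2)) {s : ℂ} (hs : s.re < 2) :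
    HurwitzZeta.hurwitzZetaEven a (1 - s) - riemannZeta (1 - s) =
      ((a : ℂ) ^ (s - 1) + hurwitzTaylorSum s a + 1 * hurwitzTaylorSum s (-a)) / 2 := by
  refine eqOn_re_lt_two_of_eqOn_re_neg
    (differentiable_hurwitzZetaEven_sub_riemannZeta a).differentiableOn
    (differentiableOn_half_cpow_add_hurwitzTaylorSum ha 1) (fun s hs => ?_) hs
  have h := HurwitzZeta.hasSum_nat_hurwitzZetaEven_of_mem_Icc (a := a) (s := 1 - s)
    ⟨ha.1.le, by linarith [ha.2]⟩ (by rw [sub_re, one_re]; linarith)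
  simp only [one_div, ← cpow_neg, neg_sub] at h
  rw [h.unique (((hasSum_natCast_add_cpow hs ha).add (hasSum_add_neg_cpow hs ha)).div_const 2)]
  ring

theorem hurwitzZetaOdd_one_sub_eq {a : ℝ} (ha : a ∈ Ioc (0 : ℝ) (1 / 2)) {s : ℂ} (hs : s.re < 2)
    {E : ℂ → ℂ} (hE : Differentiable ℂ E) (hE' : ∀ w, w ≠ 1 → E w = (w - 1) * riemannZeta w) :
    HurwitzZeta.hurwitzZetaOdd a (1 - s) =
      ((a : ℂ) ^ (s - 1) + hurwitzTaylorSum s a + -1 * hurwitzTaylorSum s (-a)) / 2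
        - a * E (2 - s) := by
  refine eqOn_re_lt_two_of_eqOn_re_neg
    ((HurwitzZeta.differentiable_hurwitzZetaOdd a).comp
      (differentiable_id.const_sub 1)).differentiableOn
    ((differentiableOn_half_cpow_add_hurwitzTaylorSum ha (-1)).sub
      (((hE.comp (differentiable_id.const_sub 2)).const_mul _).differentiableOn))
    (fun s hs => ?_) hs
  have h := HurwitzZeta.hasSum_nat_hurwitzZetaOdd_of_mem_Icc (a := a) (s := 1 - s)
    ⟨ha.1.le, by linarith [ha.2]⟩ (by rw [sub_re, one_re]; linarith)
  simp only [one_div, ← cpow_neg, neg_sub] at h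
  have hne : 2 - s ≠ 1 := fun h => by
    have := congrArg re h
    simp at this
    linarith
  simp only [Function.comp_apply, id, Pi.sub_apply]
  rw [h.unique (((hasSum_natCast_add_cpow hs ha).sub (hasSum_add_neg_cpow hs ha)).div_const 2),
    hE' _ hne]
  ring

/-- Near `x = 0`, the even Hurwitz zeta function at `1 - s` is `x ^ (s - 1) / 2` plus a function
holomorphic in `x`, with at most a simple pole in `s` at `0`. -/
theorem exists_kernel_hurwitzZetaEven : ∃ e : ℂ → ℂ → ℂ, IsHolomorphicKernel {s | s.re < 2} e ∧
    ∀ s : ℂ, s.re < 2 → s ≠ 0 → ∀ a ∈ Ioc (0 : ℝ) (1 / 2),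
      s * HurwitzZeta.hurwitzZetaEven a (1 - s) = s / 2 * (a : ℂ) ^ (s - 1) + e s a := by
  obtain ⟨E, hE, hE'⟩ := exists_differentiable_sub_one_mul_riemannZeta
  have hS := isHolomorphicKernel_hurwitzTaylorSum
  have hd : Differentiable ℂ fun s => -E (1 - s) := (hE.comp (differentiable_id.const_sub 1)).neg
  refine ⟨_, (IsHolomorphicKernel.of_left hd.differentiableOn).add
    ((IsHolomorphicKernel.of_left (f := fun s => s / 2) (by fun_prop)).mul (hS.add hS.comp_neg)),
    fun s hs h0 a ha => ?_⟩
  rw [← sub_add_cancel (HurwitzZeta.hurwitzZetaEven a (1 - s)) (riemannZeta (1 - s)),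
    hurwitzZetaEven_one_sub_eq ha hs, hE' (1 - s) (by simpa using h0)]
  ring

/-- Near `x = 0`, the odd Hurwitz zeta function at `1 - s` is `x ^ (s - 1) / 2` plus a function
holomorphic in `x` and `s`. -/
theorem exists_kernel_hurwitzZetaOdd : ∃ o : ℂ → ℂ → ℂ, IsHolomorphicKernel {s | s.re < 2} o ∧
    ∀ s : ℂ, s.re < 2 → ∀ a ∈ Ioc (0 : ℝ) (1 / 2),
      s * HurwitzZeta.hurwitzZetaOdd a (1 - s) = s / 2 * (a : ℂ) ^ (s - 1) + o s a := by
  obtain ⟨E, hE, hE'⟩ := exists_differentiable_sub_one_mul_riemannZeta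
  have hS := isHolomorphicKernel_hurwitzTaylorSum
  have hd : Differentiable ℂ fun s => -(s * E (2 - s)) :=
    (differentiable_id.mul (hE.comp (differentiable_id.const_sub 2))).neg
  refine ⟨_, ((IsHolomorphicKernel.of_left hd.differentiableOn).mul
    (.of_right differentiable_id.differentiableOn)).add
    ((IsHolomorphicKernel.of_left (f := fun s => s / 2) (by fun_prop)).mul
      (hS.add ((IsHolomorphicKernel.of_left (f := fun _ => -1) (by fun_prop)).mul hS.comp_neg))),
    fun s hs a ha => ?_⟩
  rw [hurwitzZetaOdd_one_sub_eq ha hs hE hE', id]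
  ring

/-- The Witten zeta series of type `A₂`, up to normalisation. -/
noncomputable def wittenSeries (s : ℂ) : ℂ :=
  ∑' p : ℕ+ × ℕ+, 1 / (((p.1 : ℕ) : ℂ) * ((p.2 : ℕ) : ℂ) *
    (((p.1 : ℕ) : ℂ) + ((p.2 : ℕ) : ℂ))) ^ s

theorem one_div_mul_mul_add_cpow (s : ℂ) (m n : ℕ) :
    1 / ((m : ℂ) * n * (m + n)) ^ s =
      1 / (m : ℂ) ^ s * (1 / (n : ℂ) ^ s) * (1 / ((m + n : ℕ) : ℂ) ^ s) := by
  rw [← Nat.cast_add, ← Nat.cast_mul, natCast_mul_natCast_cpow, Nat.cast_mul,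
    natCast_mul_natCast_cpow]
  simp only [one_div, mul_inv]

theorem norm_wittenSeries_term_le {σ : ℝ} (hσ : 0 < σ) {s : ℂ} (hs : σ ≤ s.re) (p : ℕ+ × ℕ+) :
    ‖1 / (((p.1 : ℕ) : ℂ) * ((p.2 : ℕ) : ℂ) * (((p.1 : ℕ) : ℂ) + ((p.2 : ℕ) : ℂ))) ^ s‖ ≤
      1 / ((p.1 : ℕ) : ℝ) ^ σ * (1 / ((p.2 : ℕ) : ℝ) ^ σ) := by
  have key : ∀ n : ℕ, 0 < n → ‖1 / (n : ℂ) ^ s‖ ≤ 1 / (n : ℝ) ^ σ := fun n hn => by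
    rw [norm_div, norm_one, norm_natCast_cpow_of_pos hn]
    have hn' : (0 : ℝ) < n := by exact_mod_cast hn
    exact one_div_le_one_div_of_le (by positivity)
      (Real.rpow_le_rpow_of_exponent_le (by exact_mod_cast hn) hs)
  rw [one_div_mul_mul_add_cpow, norm_mul, norm_mul]
  have h3 : ‖1 / (((p.1 : ℕ) + (p.2 : ℕ) : ℕ) : ℂ) ^ s‖ ≤ 1 := by
    refine (key _ (Nat.add_pos_left p.1.pos _)).trans ?_
    refine (div_le_one (by have := p.1.pos; positivity)).2 (Real.one_le_rpow ?_ hσ.le)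
    exact_mod_cast Nat.add_pos_left p.1.pos _
  refine (mul_le_of_le_one_right (by positivity) h3).trans ?_
  exact mul_le_mul (key _ p.1.pos) (key _ p.2.pos) (norm_nonneg _) (by positivity)

theorem summable_wittenSeries_bound {σ : ℝ} (hσ : 1 < σ) :
    Summable fun p : ℕ+ × ℕ+ => 1 / ((p.1 : ℕ) : ℝ) ^ σ * (1 / ((p.2 : ℕ) : ℝ) ^ σ) := by
  have h : Summable fun n : ℕ+ => 1 / ((n : ℕ) : ℝ) ^ σ :=
    (Real.summable_one_div_nat_rpow.2 hσ).comp_injective PNat.coe_injective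
  exact h.mul_of_nonneg h (fun _ => by positivity) (fun _ => by positivity)

theorem hasSum_wittenSeries {s : ℂ} (hs : 1 < s.re) :
    HasSum (fun p : ℕ+ × ℕ+ => 1 / (((p.1 : ℕ) : ℂ) * ((p.2 : ℕ) : ℂ) *
      (((p.1 : ℕ) : ℂ) + ((p.2 : ℕ) : ℂ))) ^ s) (wittenSeries s) :=
  (Summable.of_norm_bounded (summable_wittenSeries_bound hs)
    (norm_wittenSeries_term_le (by linarith) le_rfl)).hasSum

theorem analyticAt_wittenSeries {s : ℂ} (hs : 1 < s.re) : AnalyticAt ℂ wittenSeries s := by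
  set σ := (1 + s.re) / 2 with hσ
  have ho : IsOpen {z : ℂ | σ < z.re} := isOpen_lt continuous_const continuous_re
  refine (Complex.differentiableOn_tsum_of_summable_norm
    (summable_wittenSeries_bound (σ := σ) (by linarith)) (fun p => ?_) ho fun p z hz =>
    norm_wittenSeries_term_le (by linarith) (le_of_lt hz) p).analyticAt
    (ho.mem_nhds (show σ < s.re by linarith))
  have hne : ((p.1 : ℕ) : ℂ) * ((p.2 : ℕ) : ℂ) * (((p.1 : ℕ) : ℂ) + ((p.2 : ℕ) : ℂ)) ≠ 0 := by
    exact_mod_cast (mul_pos (mul_pos p.1.pos p.2.pos) (Nat.add_pos_left p.1.pos _)).ne'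
  exact ((differentiable_const 1).div (differentiable_id.const_cpow (Or.inl hne))
    fun z => by simp [cpow_eq_zero_iff, hne]).differentiableOn

theorem integral_cos_two_pi_mul_int (k : ℤ) :
    ∫ x in (0 : ℝ)..(1 / 2), Real.cos (2 * Real.pi * x * k) = if k = 0 then 1 / 2 else 0 := by
  split_ifs with h
  · simp [h]
  · have hc : (2 * Real.pi * k) ≠ 0 := mul_ne_zero (by positivity) (by exact_mod_cast h)
    simp only [mul_right_comm (2 * Real.pi) _ (k : ℝ)]
    rw [intervalIntegral.integral_comp_mul_left (fun x => Real.cos x) hc, integral_cos]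
    rw [show 2 * Real.pi * k * (1 / 2) = k * Real.pi by ring, Real.sin_int_mul_pi]
    simp

theorem integral_quarter_sum_cos (ε : ℝ) {a : ℕ} (ha : a ≠ 0) (b c : ℕ) :
    ∫ x in (0 : ℝ)..(1 / 2), (ε * Real.cos (2 * Real.pi * x * (a + b + c)) +
      ε * Real.cos (2 * Real.pi * x * (a + b - c)) + Real.cos (2 * Real.pi * x * (a - b + c)) +
      Real.cos (2 * Real.pi * x * (a - b - c))) / 4 =
    ε / 8 * (if a + b = c then 1 else 0) + 1 / 8 * (if a + c = b then 1 else 0) +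
      1 / 8 * (if b + c = a then 1 else 0) := by
  have h1 := integral_cos_two_pi_mul_int (a + b + c)
  have h2 := integral_cos_two_pi_mul_int (a + b - c)
  have h3 := integral_cos_two_pi_mul_int (a - b + c)
  have h4 := integral_cos_two_pi_mul_int (a - b - c)
  push_cast at h1 h2 h3 h4
  have i : ∀ (r k : ℝ), IntervalIntegrable (fun x : ℝ => r * Real.cos (2 * Real.pi * x * k)) volume
      0 (1 / 2) := fun r k => (by fun_prop : Continuous _).intervalIntegrable _ _
  have i' : ∀ k : ℝ, IntervalIntegrable (fun x : ℝ => Real.cos (2 * Real.pi * x * k)) volume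
      0 (1 / 2) := fun k => (by fun_prop : Continuous _).intervalIntegrable _ _
  rw [intervalIntegral.integral_div, intervalIntegral.integral_add (((i _ _).add (i _ _)).add (i' _)) (i' _),
    intervalIntegral.integral_add ((i _ _).add (i _ _)) (i' _),
    intervalIntegral.integral_add (i _ _) (i _ _), intervalIntegral.integral_const_mul,
    intervalIntegral.integral_const_mul, h1, h2, h3, h4,
    if_neg (by omega), if_congr (show (a + b - c : ℤ) = 0 ↔ a + b = c by omega) rfl rfl,
    if_congr (show (a - b + c : ℤ) = 0 ↔ a + c = b by omega) rfl rfl,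
    if_congr (show (a - b - c : ℤ) = 0 ↔ b + c = a by omega) rfl rfl]
  split_ifs <;> ring

theorem hasSum_triple_of_injective {s : ℂ} (hs : 1 < s.re) (r : (ℕ × ℕ) × ℕ → Prop)
    [DecidablePred r] (i : ℕ+ × ℕ+ → (ℕ × ℕ) × ℕ) (hi : Function.Injective i)
    (hr : ∀ q, q.1.1 ≠ 0 → q.1.2 ≠ 0 → q.2 ≠ 0 → (r q ↔ q ∈ range i))
    (hval : ∀ p, 1 / ((i p).1.1 : ℂ) ^ s * (1 / ((i p).1.2 : ℂ) ^ s) * (1 / ((i p).2 : ℂ) ^ s) =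
      1 / (p.1 : ℂ) ^ s * (1 / (p.2 : ℂ) ^ s) * (1 / ((p.1 + p.2 : ℕ) : ℂ) ^ s))
    (hne : ∀ p, (i p).1.1 ≠ 0 ∧ (i p).1.2 ≠ 0 ∧ (i p).2 ≠ 0) :
    HasSum (fun q : (ℕ × ℕ) × ℕ => 1 / (q.1.1 : ℂ) ^ s * (1 / (q.1.2 : ℂ) ^ s) *
      (1 / (q.2 : ℂ) ^ s) * (if r q then 1 else 0)) (wittenSeries s) := by
  have hs0 : s ≠ 0 := fun h => by simp [h] at hs; linarith
  refine (hi.hasSum_iff fun q hq => ?_).1 ((hasSum_wittenSeries hs).congr_fun fun p => ?_)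
  · by_cases h : q.1.1 ≠ 0 ∧ q.1.2 ≠ 0 ∧ q.2 ≠ 0
    · rw [if_neg (fun h' => hq ((hr q h.1 h.2.1 h.2.2).1 h')), mul_zero]
    · simp only [not_and_or, not_not] at h
      rcases h with h | h | h <;> simp [h, zero_cpow hs0]
  · obtain ⟨h1, h2, h3⟩ := hne p
    simp only [Function.comp_apply]
    rw [if_pos ((hr _ h1 h2 h3).2 (mem_range_self p)), mul_one, hval, one_div_mul_mul_add_cpow]

theorem HasSum.sq_mul_triple {f g : ℕ → ℂ} {a b : ℂ} (hf : HasSum f a) (hg : HasSum g b) :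
    HasSum (fun q : (ℕ × ℕ) × ℕ => f q.1.1 * f q.1.2 * g q.2) (a ^ 2 * b) := by
  have hff : Summable fun q : ℕ × ℕ => ‖f q.1 * f q.2‖ :=
    Summable.mul_norm (f := f) (g := f) hf.summable.norm hf.summable.norm
  have hffg : Summable fun q : (ℕ × ℕ) × ℕ => f q.1.1 * f q.1.2 * g q.2 :=
    summable_mul_of_summable_norm (f := fun q : ℕ × ℕ => f q.1 * f q.2) (g := g) hff
      hg.summable.norm
  rw [sq]
  exact (HasSum.mul hf hf hff.of_norm).mul hg hffg

theorem integral_sq_mul_cosZeta {s : ℂ} (hs : 1 < s.re) {ε : ℝ} {P : ℕ → ℝ → ℝ}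
    (hPc : ∀ n, Continuous (P n)) (hP1 : ∀ n x, |P n x| ≤ 1) {f : ℝ → ℂ}
    (hf : ∀ x, HasSum (fun n => (P n x : ℂ) / (n : ℂ) ^ s) (f x))
    (hP : ∀ (a b c : ℕ) (x : ℝ), P a x * P b x * Real.cos (2 * Real.pi * x * c) =
      (ε * Real.cos (2 * Real.pi * x * (a + b + c)) +
      ε * Real.cos (2 * Real.pi * x * (a + b - c)) + Real.cos (2 * Real.pi * x * (a - b + c)) +
      Real.cos (2 * Real.pi * x * (a - b - c))) / 4) :
    ∫ x in (0 : ℝ)..(1 / 2), f x ^ 2 * HurwitzZeta.cosZeta x s = (ε + 2) / 8 * wittenSeries s := by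
  have hs0 : s ≠ 0 := fun h => by simp [h] at hs; linarith
  have hu : HasSum (fun n : ℕ => 1 / (n : ℂ) ^ s) (∑' n : ℕ, 1 / (n : ℂ) ^ s) :=
    (Complex.summable_one_div_nat_cpow.2 hs).hasSum
  obtain ⟨u, hudef⟩ : ∃ u : (ℕ × ℕ) × ℕ → ℂ, ∀ q, u q =
    1 / (q.1.1 : ℂ) ^ s * (1 / (q.1.2 : ℂ) ^ s) * (1 / (q.2 : ℂ) ^ s) := ⟨_, fun _ => rfl⟩
  have hu3 : Summable fun q => ‖u q‖ := by
    simpa only [hudef] using (HasSum.sq_mul_triple hu hu).summable.norm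
  obtain ⟨T, hT⟩ : ∃ T : (ℕ × ℕ) × ℕ → ℝ → ℝ, ∀ q x, T q x =
    P q.1.1 x * P q.1.2 x * Real.cos (2 * Real.pi * x * q.2) := ⟨_, fun _ _ => rfl⟩
  have hTc : ∀ q, Continuous (T q) := fun q => by
    simp only [funext (hT q)]
    exact ((hPc _).mul (hPc _)).mul (by fun_prop)
  have hT1 : ∀ q x, ‖(T q x : ℂ)‖ ≤ 1 := fun q x => by
    rw [norm_real, Real.norm_eq_abs, hT, abs_mul, abs_mul]
    exact mul_le_one₀ (mul_le_one₀ (hP1 _ _) (abs_nonneg _) (hP1 _ _)) (abs_nonneg _)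
      (Real.abs_cos_le_one _)
  have hsum : ∀ x : ℝ, HasSum (fun q => u q * T q x) (f x ^ 2 * HurwitzZeta.cosZeta x s) := by
    intro x
    refine (HasSum.sq_mul_triple (hf x) (HurwitzZeta.hasSum_nat_cosZeta x hs)).congr_fun
      fun q => ?_
    rw [hudef, hT]
    push_cast
    ring
  have hintegral := intervalIntegral.hasSum_integral_of_dominated_convergence (a := 0) (b := 1 / 2)
    (μ := volume) (F := fun q (x : ℝ) => u q * T q x)
    (f := fun x : ℝ => f x ^ 2 * HurwitzZeta.cosZeta x s) (fun q _ => ‖u q‖)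
    (fun q => (continuous_const.mul (continuous_ofReal.comp (hTc q))).aestronglyMeasurable)
    (fun q => Eventually.of_forall fun x _ => by
      rw [norm_mul]; exact mul_le_of_le_one_right (norm_nonneg _) (hT1 q x))
    (Eventually.of_forall fun x _ => hu3) intervalIntegrable_const
    (Eventually.of_forall fun x _ => hsum x)
  have w1 := hasSum_triple_of_injective hs (fun q => q.1.1 + q.1.2 = q.2)
    (fun p => ((p.1, p.2), p.1 + p.2))
    (fun p q h => by simp only [Prod.mk.injEq, PNat.coe_inj] at h; exact Prod.ext h.1.1 h.1.2)
    (fun ⟨⟨a, b⟩, c⟩ ha hb hc => ⟨fun h => ⟨(⟨a, Nat.pos_of_ne_zero ha⟩, ⟨b, Nat.pos_of_ne_zero hb⟩),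
      by simpa using h⟩, fun ⟨p, hp⟩ => by simp only [Prod.mk.injEq] at hp ⊢; omega⟩)
    (fun p => rfl) (fun p => ⟨p.1.ne_zero, p.2.ne_zero, by have := p.1.pos; dsimp only; omega⟩)
  have w2 := hasSum_triple_of_injective hs (fun q => q.1.1 + q.2 = q.1.2)
    (fun p => ((p.1, p.1 + p.2), p.2))
    (fun p q h => by simp only [Prod.mk.injEq, PNat.coe_inj] at h; exact Prod.ext h.1.1 h.2)
    (fun ⟨⟨a, b⟩, c⟩ ha hb hc => ⟨fun h => ⟨(⟨a, Nat.pos_of_ne_zero ha⟩, ⟨c, Nat.pos_of_ne_zero hc⟩),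
      by simpa using h⟩, fun ⟨p, hp⟩ => by simp only [Prod.mk.injEq] at hp ⊢; omega⟩)
    (fun p => by ring) (fun p => ⟨p.1.ne_zero, by have := p.1.pos; dsimp only; omega, p.2.ne_zero⟩)
  have w3 := hasSum_triple_of_injective hs (fun q => q.1.2 + q.2 = q.1.1)
    (fun p => ((p.1 + p.2, p.1), p.2))
    (fun p q h => by simp only [Prod.mk.injEq, PNat.coe_inj] at h; exact Prod.ext h.1.2 h.2)
    (fun ⟨⟨a, b⟩, c⟩ ha hb hc => ⟨fun h => ⟨(⟨b, Nat.pos_of_ne_zero hb⟩, ⟨c, Nat.pos_of_ne_zero hc⟩),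
      by simpa using h⟩, fun ⟨p, hp⟩ => by simp only [Prod.mk.injEq] at hp ⊢; omega⟩)
    (fun p => by ring) (fun p => ⟨by have := p.1.pos; dsimp only; omega, p.1.ne_zero, p.2.ne_zero⟩)
  have hW := ((w1.mul_left ((ε : ℂ) / 8)).add (w2.mul_left (1 / 8))).add (w3.mul_left (1 / 8))
  rw [show (ε + 2) / 8 * wittenSeries s = ε / 8 * wittenSeries s + 1 / 8 * wittenSeries s +
    1 / 8 * wittenSeries s by ring]
  refine hintegral.unique (hW.congr_fun fun q => ?_)
  rw [intervalIntegral.integral_const_mul, intervalIntegral.integral_ofReal]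
  by_cases h : q.1.1 = 0
  · simp [hudef, h, zero_cpow hs0]
  · simp only [hT, hP, hudef]
    rw [integral_quarter_sum_cos ε h]
    split_ifs <;> push_cast <;> ring

theorem integral_cosZeta_sq_mul_cosZeta {s : ℂ} (hs : 1 < s.re) :
    ∫ x in (0 : ℝ)..(1 / 2), HurwitzZeta.cosZeta x s ^ 2 * HurwitzZeta.cosZeta x s =
      3 / 8 * wittenSeries s := by
  rw [integral_sq_mul_cosZeta hs (ε := 1) (P := fun n x => Real.cos (2 * Real.pi * x * n))
    (fun n => by fun_prop) (fun n x => Real.abs_cos_le_one _)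
    (fun x => HurwitzZeta.hasSum_nat_cosZeta x hs) fun a b c x => ?_]
  · norm_num
  · simp only [mul_add, mul_sub, Real.cos_add, Real.cos_sub, Real.sin_add, Real.sin_sub]
    ring

theorem integral_sinZeta_sq_mul_cosZeta {s : ℂ} (hs : 1 < s.re) :
    ∫ x in (0 : ℝ)..(1 / 2), HurwitzZeta.sinZeta x s ^ 2 * HurwitzZeta.cosZeta x s =
      1 / 8 * wittenSeries s := by
  rw [integral_sq_mul_cosZeta hs (ε := -1) (P := fun n x => Real.sin (2 * Real.pi * x * n))
    (fun n => by fun_prop) (fun n x => Real.abs_sin_le_one _)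
    (fun x => HurwitzZeta.hasSum_nat_sinZeta x hs) fun a b c x => ?_]
  · norm_num
  · simp only [mul_add, mul_sub, Real.cos_add, Real.cos_sub, Real.sin_add, Real.sin_sub]
    ring

theorem MeromorphicOn.eventuallyEq_nhdsNE_of_isPreconnected {U : Set ℂ} {f g : ℂ → ℂ}
    (hU : IsPreconnected U) (hf : MeromorphicOn f U) (hg : MeromorphicOn g U) {z w : ℂ}
    (hz : z ∈ U) (hw : w ∈ U) (h : f =ᶠ[𝓝 w] g) : f =ᶠ[𝓝[≠] z] g := by
  have hfg : MeromorphicOn (f - g) U := hf.sub hg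
  have hw0 : meromorphicOrderAt (f - g) w = ⊤ := meromorphicOrderAt_eq_top_iff.2 <| by
    filter_upwards [h.filter_mono nhdsWithin_le_nhds] with x hx using by simp [hx]
  have hz0 : meromorphicOrderAt (f - g) z = ⊤ := by
    by_contra hne
    exact hfg.meromorphicOrderAt_ne_top_of_isPreconnected hU hz hw hne hw0
  filter_upwards [meromorphicOrderAt_eq_top_iff.1 hz0] with x hx using sub_eq_zero.1 hx

theorem HasAtMostSimplePole.le_meromorphicOrderAt_pow_mul {J c g : ℂ → ℂ} {z : ℂ}
    (hJ : HasAtMostSimplePole J z) (hc : AnalyticAt ℂ c z) (hcz : c z = 0) (hg : AnalyticAt ℂ g z)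
    (n : ℕ) : ((n : ℤ) : WithTop ℤ) ≤ meromorphicOrderAt (c ^ (n + 1) * g * J) z := by
  have h1 : (1 : WithTop ℤ) ≤ meromorphicOrderAt c z := by
    rw [hc.meromorphicOrderAt_eq]
    have : (1 : ℕ∞) ≤ analyticOrderAt c z :=
      Order.one_le_iff_pos.2 (pos_iff_ne_zero.2 (hc.analyticOrderAt_ne_zero.2 hcz))
    cases h : analyticOrderAt c z with
    | top => simp
    | coe m =>
      rw [h] at this
      have : 1 ≤ m := by exact_mod_cast this
      rw [ENat.map_natCast]
      exact_mod_cast this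
  have hn : (((n + 1 : ℕ) : ℤ) : WithTop ℤ) ≤ meromorphicOrderAt (c ^ (n + 1)) z := by
    induction n with
    | zero => simpa using h1
    | succ n ih =>
      rw [pow_succ, meromorphicOrderAt_mul (hc.pow _).meromorphicAt hc.meromorphicAt]
      simpa using add_le_add ih h1
  have hcg : AnalyticAt ℂ (c ^ (n + 1)) z := hc.pow _
  rw [meromorphicOrderAt_mul (hcg.mul hg).meromorphicAt hJ.1,
    meromorphicOrderAt_mul hcg.meromorphicAt hg.meromorphicAt]
  refine le_trans ?_ (add_le_add (add_le_add hn hg.meromorphicOrderAt_nonneg) hJ.2)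
  simp only [add_zero]
  exact WithTop.coe_le_coe.2 (show (n : ℤ) ≤ ((n + 1 : ℕ) : ℤ) + -1 by push_cast; omega)

theorem MeromorphicNFAt.analyticAt_and_eq_zero {f : ℂ → ℂ} {z : ℂ} (hf : MeromorphicNFAt f z)
    (h : 1 ≤ meromorphicOrderAt f z) : AnalyticAt ℂ f z ∧ f z = 0 := by
  refine ⟨hf.meromorphicOrderAt_nonneg_iff_analyticAt.1 (le_trans (by decide) h), ?_⟩
  by_contra hne
  rw [hf.meromorphicOrderAt_eq_zero_iff.2 hne] at h
  exact absurd h (by decide)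

theorem AnalyticAt.deriv_eq_zero_of_two_le {f : ℂ → ℂ} {z : ℂ} (hf : AnalyticAt ℂ f z)
    (h0 : f z = 0) (h : 2 ≤ meromorphicOrderAt f z) : deriv f z = 0 := by
  by_contra hne
  have h1 := hf.analyticOrderAt_sub_eq_one_of_deriv_ne_zero hne
  simp only [h0, sub_zero] at h1
  rw [hf.meromorphicOrderAt_eq, h1] at h
  exact absurd h (by decide)

/-- The factor relating the periodic zeta functions at `s` to Hurwitz zeta functions at `1 - s`,
without its trigonometric part. -/
noncomputable def gammaFactor (s : ℂ) : ℂ :=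
  2 * (2 * Real.pi) ^ (-(1 - s)) * Gamma (1 - s)

theorem analyticAt_two_pi_cpow (s : ℂ) :
    AnalyticAt ℂ (fun s : ℂ => 2 * (2 * Real.pi : ℂ) ^ (-(1 - s))) s := by
  refine (Differentiable.analyticAt ?_ s)
  have : (2 * Real.pi : ℂ) ≠ 0 := by exact_mod_cast Real.two_pi_pos.ne'
  exact (Differentiable.const_cpow (by fun_prop) (Or.inl this)).const_mul 2

theorem meromorphicAt_gammaFactor (s : ℂ) : MeromorphicAt gammaFactor s :=
  (analyticAt_two_pi_cpow s).meromorphicAt.mul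
    ((Meromorphic.Gamma (1 - s)).comp_analyticAt (f := Gamma) (g := fun s => 1 - s) (by fun_prop))

theorem analyticAt_gammaFactor {s : ℂ} (hs : s.re < 1) : AnalyticAt ℂ gammaFactor s := by
  have ho : IsOpen {z : ℂ | z.re < 1} := isOpen_lt continuous_re continuous_const
  refine (analyticAt_two_pi_cpow s).mul
    (DifferentiableOn.analyticAt (s := {z : ℂ | z.re < 1}) (fun z hz => ?_) (ho.mem_nhds hs))
  refine DifferentiableAt.differentiableWithinAt ?_
  refine (differentiableAt_Gamma _ fun n h => ?_).comp z (by fun_prop)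
  have := congrArg re h
  have hn : (0 : ℝ) ≤ n := n.cast_nonneg
  simp at this hz
  linarith

theorem cosZeta_eq_gammaFactor_mul (a : UnitAddCircle) {s : ℂ} (h1 : 1 < s.re) (h2 : s.re < 2) :
    HurwitzZeta.cosZeta a s =
      gammaFactor s * cos (Real.pi * (1 - s) / 2) * HurwitzZeta.hurwitzZetaEven a (1 - s) := by
  have := HurwitzZeta.cosZeta_one_sub a (s := 1 - s) fun n h => ?_
  · rwa [sub_sub_cancel] at this
  · have := congrArg re (sub_right_injective h)
    rw [natCast_re] at this
    have l1 : 1 < n := by exact_mod_cast this ▸ h1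
    have l2 : n < 2 := by exact_mod_cast this ▸ h2
    omega

theorem sinZeta_eq_gammaFactor_mul (a : UnitAddCircle) {s : ℂ} (h1 : 1 < s.re) (h2 : s.re < 2) :
    HurwitzZeta.sinZeta a s =
      gammaFactor s * sin (Real.pi * (1 - s) / 2) * HurwitzZeta.hurwitzZetaOdd a (1 - s) := by
  have := HurwitzZeta.sinZeta_one_sub a (s := 1 - s) fun n h => ?_
  · rwa [sub_sub_cancel] at this
  · have : s.re = ((n + 1 : ℕ) : ℂ).re := by
      rw [show s = ((n + 1 : ℕ) : ℂ) by push_cast; linear_combination -h]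
    rw [natCast_re] at this
    have l1 : 1 < n + 1 := by exact_mod_cast this ▸ h1
    have l2 : n + 1 < 2 := by exact_mod_cast this ▸ h2
    omega

/-- On the strip `1 < re s < 4 / 3` the Witten zeta series has two expressions as the product of
an explicit factor and a function with at most simple poles. -/
theorem exists_wittenSeries_eq :
    ∃ J₁ J₂ : ℂ → ℂ, (∀ z, z.re < 2 → HasAtMostSimplePole J₁ z) ∧
      (∀ z, z.re < 2 → HasAtMostSimplePole J₂ z) ∧
      ∀ s : ℂ, 1 < s.re → s.re < 4 / 3 →
        wittenSeries s = (gammaFactor s * cos (Real.pi * (1 - s) / 2)) ^ 3 *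
          (8 / 3 * (s⁻¹) ^ 3) * J₁ s ∧
        wittenSeries s = (gammaFactor s * sin (Real.pi * (1 - s) / 2)) ^ 2 *
          (8 * (gammaFactor s * cos (Real.pi * (1 - s) / 2)) * (s⁻¹) ^ 3) * J₂ s := by
  obtain ⟨e, he, hev⟩ := exists_kernel_hurwitzZetaEven
  obtain ⟨o, ho, hov⟩ := exists_kernel_hurwitzZetaOdd
  have hU : IsOpen {s : ℂ | s.re < 2} := isOpen_lt continuous_re continuous_const
  obtain ⟨J₁, hJ₁, h₁⟩ := exists_hasAtMostSimplePole_integral_sq_mul hU he he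
  obtain ⟨J₂, hJ₂, h₂⟩ := exists_hasAtMostSimplePole_integral_sq_mul hU ho he
  refine ⟨J₁, J₂, hJ₁, hJ₂, fun s l1 l2 => ?_⟩
  have hs2 : s.re < 2 := by linarith
  have hs0 : s ≠ 0 := fun h => by simp [h] at l1; linarith
  have hcos : ∀ x ∈ Ioc (0 : ℝ) (1 / 2), HurwitzZeta.cosZeta x s =
      gammaFactor s * cos (Real.pi * (1 - s) / 2) * s⁻¹ *
        (s / 2 * (x : ℂ) ^ (s - 1) + e s x) := fun x hx => by
    rw [← hev s hs2 hs0 x hx, cosZeta_eq_gammaFactor_mul _ l1 hs2]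
    field_simp
  have hsin : ∀ x ∈ Ioc (0 : ℝ) (1 / 2), HurwitzZeta.sinZeta x s =
      gammaFactor s * sin (Real.pi * (1 - s) / 2) * s⁻¹ *
        (s / 2 * (x : ℂ) ^ (s - 1) + o s x) := fun x hx => by
    rw [← hov s hs2 x hx, sinZeta_eq_gammaFactor_mul _ l1 hs2]
    field_simp
  have hI : Set.uIoc (0 : ℝ) (1 / 2) = Ioc 0 (1 / 2) := uIoc_of_le (by norm_num)
  constructor
  · have hintegral : ∫ x in (0 : ℝ)..(1 / 2), HurwitzZeta.cosZeta x s ^ 2 * HurwitzZeta.cosZeta x s =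
        (gammaFactor s * cos (Real.pi * (1 - s) / 2) * s⁻¹) ^ 3 * J₁ s := by
      rw [h₁ s hs2 l1 l2, ← intervalIntegral.integral_const_mul]
      refine intervalIntegral.integral_congr_ae (Eventually.of_forall fun x hx => ?_)
      rw [hcos x (hI ▸ hx)]
      ring
    rw [integral_cosZeta_sq_mul_cosZeta l1] at hintegral
    linear_combination 8 / 3 * hintegral
  · have hintegral : ∫ x in (0 : ℝ)..(1 / 2), HurwitzZeta.sinZeta x s ^ 2 * HurwitzZeta.cosZeta x s =
        (gammaFactor s * sin (Real.pi * (1 - s) / 2) * s⁻¹) ^ 2 *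
          (gammaFactor s * cos (Real.pi * (1 - s) / 2) * s⁻¹) * J₂ s := by
      rw [h₂ s hs2 l1 l2, ← intervalIntegral.integral_const_mul]
      refine intervalIntegral.integral_congr_ae (Eventually.of_forall fun x hx => ?_)
      rw [hcos x (hI ▸ hx), hsin x (hI ▸ hx)]
      ring
    rw [integral_sinZeta_sq_mul_cosZeta l1] at hintegral
    linear_combination 8 * hintegral

theorem exists_meromorphic_continuation_wittenSeries :
    ∃ F : ℂ → ℂ, (∀ z, MeromorphicNFAt F z) ∧ (∀ s, 1 < s.re → F s = wittenSeries s) ∧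
      (∀ z, z.re < 0 → cos (Real.pi * (1 - z) / 2) = 0 → 2 ≤ meromorphicOrderAt F z) ∧
      (∀ z, z.re < 0 → sin (Real.pi * (1 - z) / 2) = 0 → 1 ≤ meromorphicOrderAt F z) := by
  obtain ⟨J₁, J₂, hJ₁, hJ₂, hW⟩ := exists_wittenSeries_eq
  set c : ℂ → ℂ := fun s => gammaFactor s * cos (Real.pi * (1 - s) / 2) with hc
  set d : ℂ → ℂ := fun s => gammaFactor s * sin (Real.pi * (1 - s) / 2) with hd
  set F₁ : ℂ → ℂ := c ^ 3 * (fun s => 8 / 3 * (s⁻¹) ^ 3) * J₁ with hF₁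
  set F₂ : ℂ → ℂ := d ^ 2 * (fun s => 8 * c s * (s⁻¹) ^ 3) * J₂ with hF₂
  set U : Set ℂ := {s | s.re < 2} with hU
  have hUc : IsPreconnected U := (convex_halfSpace_re_lt 2).isPreconnected
  have hcos : ∀ z, AnalyticAt ℂ (fun s : ℂ => cos (Real.pi * (1 - s) / 2)) z := fun z => by fun_prop
  have hsin : ∀ z, AnalyticAt ℂ (fun s : ℂ => sin (Real.pi * (1 - s) / 2)) z := fun z => by fun_prop
  have hcm : ∀ z, MeromorphicAt c z := fun z =>
    (meromorphicAt_gammaFactor z).mul (hcos z).meromorphicAt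
  have hdm : ∀ z, MeromorphicAt d z := fun z =>
    (meromorphicAt_gammaFactor z).mul (hsin z).meromorphicAt
  have hinv : ∀ z : ℂ, MeromorphicAt (fun s : ℂ => (s⁻¹) ^ 3) z := fun z =>
    (MeromorphicAt.id z).inv.pow 3
  have hm₁ : MeromorphicOn F₁ U := fun z hz =>
    (((hcm z).pow 3).mul ((MeromorphicAt.const _ z).mul (hinv z))).mul (hJ₁ z hz).1
  have hm₂ : MeromorphicOn F₂ U := fun z hz =>
    (((hdm z).pow 2).mul (((MeromorphicAt.const _ z).mul (hcm z)).mul (hinv z))).mul (hJ₂ z hz).1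
  have hF12 : ∀ z ∈ U, F₁ =ᶠ[𝓝[≠] z] F₂ := by
    intro z hz
    refine MeromorphicOn.eventuallyEq_nhdsNE_of_isPreconnected hUc hm₁ hm₂ hz
      (w := ((7 / 6 : ℝ) : ℂ)) (by simp only [hU, mem_ofPred_eq, ofReal_re]; norm_num) ?_
    have h1 : ∀ᶠ s : ℂ in 𝓝 ((7 / 6 : ℝ) : ℂ), 1 < s.re :=
      (isOpen_lt continuous_const continuous_re).mem_nhds
        (by simp only [mem_ofPred_eq, ofReal_re]; norm_num)
    have h2 : ∀ᶠ s : ℂ in 𝓝 ((7 / 6 : ℝ) : ℂ), s.re < 4 / 3 :=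
      (isOpen_lt continuous_re continuous_const).mem_nhds
        (by simp only [mem_ofPred_eq, ofReal_re]; norm_num)
    filter_upwards [h1, h2] with s l1 l2
    exact (hW s l1 l2).1.symm.trans (hW s l1 l2).2
  classical
  set F₀ : ℂ → ℂ := fun s => if 1 < s.re then wittenSeries s else F₁ s with hF₀
  have heq₁ : ∀ z : ℂ, z.re < 4 / 3 → F₀ =ᶠ[𝓝 z] F₁ := fun z hz => by
    filter_upwards [(isOpen_lt continuous_re continuous_const).mem_nhds hz] with s hs
    by_cases h : 1 < s.re
    · exact (if_pos h).trans (hW s h hs).1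
    · exact if_neg h
  have heq₂ : ∀ z : ℂ, 1 < z.re → F₀ =ᶠ[𝓝 z] wittenSeries := fun z hz => by
    filter_upwards [(isOpen_lt continuous_const continuous_re).mem_nhds hz] with s hs using if_pos hs
  have han : ∀ z : ℂ, 1 < z.re → AnalyticAt ℂ F₀ z := fun z hz =>
    (analyticAt_wittenSeries hz).congr (heq₂ z hz).symm
  have hm₀ : MeromorphicOn F₀ univ := fun z _ => by
    by_cases h : 1 < z.re
    · exact (han z h).meromorphicAt
    · exact (hm₁ z (by simp only [hU, mem_ofPred_eq]; linarith)).congr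
        ((heq₁ z (by linarith)).symm.filter_mono nhdsWithin_le_nhds)
  have hord : ∀ z : ℂ, z.re < 0 → meromorphicOrderAt (toMeromorphicNFOn F₀ univ) z =
      meromorphicOrderAt F₁ z := fun z hz => by
    rw [meromorphicOrderAt_toMeromorphicNFOn hm₀ (mem_univ z)]
    exact meromorphicOrderAt_congr ((heq₁ z (by linarith)).filter_mono nhdsWithin_le_nhds)
  have hga : ∀ z : ℂ, z.re < 0 → AnalyticAt ℂ (fun s : ℂ => (s⁻¹) ^ 3) z := fun z hz =>
    (analyticAt_id.inv fun h => by simp only [id_eq] at h; simp [h] at hz).pow 3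
  have hca : ∀ z : ℂ, z.re < 0 → AnalyticAt ℂ c z := fun z hz =>
    (analyticAt_gammaFactor (by linarith)).mul (hcos z)
  refine ⟨toMeromorphicNFOn F₀ univ, fun z => meromorphicNFOn_toMeromorphicNFOn F₀ univ (mem_univ z),
    fun s hs => ?_, fun z hz h0 => ?_, fun z hz h0 => ?_⟩
  · rw [toMeromorphicNFOn_eq_toMeromorphicNFAt hm₀ (mem_univ s),
      toMeromorphicNFAt_eq_self.2 (han s hs).meromorphicNFAt]
    exact if_pos hs
  · rw [hord z hz]
    exact (hJ₁ z (by linarith)).le_meromorphicOrderAt_pow_mul (hca z hz) (by simp [hc, h0])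
      (analyticAt_const.mul (hga z hz)) 2
  · rw [hord z hz, meromorphicOrderAt_congr (hF12 z (by simp only [hU, mem_ofPred_eq]; linarith))]
    exact (hJ₂ z (by linarith)).le_meromorphicOrderAt_pow_mul
      ((analyticAt_gammaFactor (by linarith)).mul (hsin z)) (by simp [h0])
      ((analyticAt_const.mul (hca z hz)).mul (hga z hz)) 1

end

/-- The Witten zeta function of `A₂` (the double series
`Σ_{m,n≥1} (mn(m+n))^{-s}`) extends meromorphically to `ℂ` and vanishes to order at least `2`
at every negative even integer and to order at least `1` at every negative odd integer. -/
theorem stmt_6 :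
    ∃ F : ℂ → ℂ,
      (∀ z : ℂ, MeromorphicAt F z) ∧
      (∀ s : ℂ, 1 < s.re →
        F s = ∑' p : ℕ+ × ℕ+, 1 / (((p.1 : ℕ) : ℂ) * ((p.2 : ℕ) : ℂ) *
          (((p.1 : ℕ) : ℂ) + ((p.2 : ℕ) : ℂ))) ^ s) ∧
      (∀ k : ℕ, 0 < k →
        (AnalyticAt ℂ F (-(2 * (k : ℂ))) ∧ F (-(2 * (k : ℂ))) = 0 ∧
          deriv F (-(2 * (k : ℂ))) = 0) ∧
        (AnalyticAt ℂ F (-(2 * (k : ℂ) - 1)) ∧ F (-(2 * (k : ℂ) - 1)) = 0)) := by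
  obtain ⟨F, hF, hW, hcos, hsin⟩ := exists_meromorphic_continuation_wittenSeries
  refine ⟨F, fun z => (hF z).meromorphicAt, hW, fun k hk => ?_⟩
  have hk' : (1 : ℝ) ≤ k := by exact_mod_cast hk
  have h2 := hcos (-(2 * (k : ℂ))) (by simp; linarith) (cos_eq_zero_iff.2 ⟨k, by push_cast; ring⟩)
  have h1 := hsin (-(2 * (k : ℂ) - 1)) (by simp; linarith)
    (sin_eq_zero_iff.2 ⟨k, by push_cast; ring⟩)
  obtain ⟨ha, h0⟩ := (hF (-(2 * (k : ℂ)))).analyticAt_and_eq_zero (le_trans (by decide) h2)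
  exact ⟨⟨ha, h0, ha.deriv_eq_zero_of_two_le h0 h2⟩, (hF _).analyticAt_and_eq_zero h1⟩
end
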